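/- arXiv:2210.05627 — 2 statements merged into one kernel-verified Lean document; each statement's English description precedes it below -/
import Mathlib

section
/- For every t ∈ [0,1] and every even integer r ≥ 2, the pair correlations C_s(t) := ℙ(O_0(t) ∩ O_s(t)) − ℙ(O_0(t))·ℙ(O_s(t)) satisfy C_{r+1}(t) + C_r(t) = −(1/2) e^{−2t} ∑_{i=r+1}^{∞} (−2t)^i/i!. -/
open MeasureTheory Set

/-- `P` is the infinite product over `ℤ` of the uniform probability measure on `[0,1]`,
characterized by its values on cylinder sets. -/
def IsUniformProduct (P : Measure (ℤ → ℝ)) : Prop :=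
  ∀ (F : Finset ℤ) (A : ℤ → Set ℝ), (∀ i ∈ F, MeasurableSet (A i)) →
    P {T | ∀ i ∈ F, T i ∈ A i} = ∏ i ∈ F, (volume.restrict (Icc (0 : ℝ) 1)) (A i)

/-- The event `G_{jk}^s(t)`. -/
def G (t : ℝ) (s : ℤ) (j k : ℕ) : Set (ℤ → ℝ) :=
  {T | T s < t ∧
    (∀ i : ℕ, i < 2 * j → T (s - i - 1) < T (s - i)) ∧
    T (s - 2 * j) < T (s - 2 * j - 1) ∧
    (∀ i : ℕ, i < 2 * k → T (s + i + 1) < T (s + i)) ∧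
    T (s + 2 * k) < T (s + 2 * k + 1)}

/-- The event that site `s` is occupied by time `t`. -/
def O (t : ℝ) (s : ℤ) : Set (ℤ → ℝ) := ⋃ (j : ℕ) (k : ℕ), G t s j k

open Function

noncomputable section

/-- Uniform measure on the unit interval. -/
def nu : Measure ℝ := volume.restrict (Icc (0 : ℝ) 1)

instance : IsProbabilityMeasure nu := ⟨by simp [nu]⟩

/-- Bounded measurable. -/
def BM {α : Type*} [MeasurableSpace α] (F : α → ℝ) : Prop :=
  Measurable F ∧ ∃ C, ∀ x, |F x| ≤ C

lemma BM.integrable {α : Type*} [MeasurableSpace α] {F : α → ℝ} (h : BM F) (μ : Measure α)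
    [IsFiniteMeasure μ] : Integrable F μ := by
  obtain ⟨h1, C, hC⟩ := h
  exact Integrable.of_bound h1.aestronglyMeasurable C (by simpa using Filter.Eventually.of_forall hC)

lemma BM.mul {α : Type*} [MeasurableSpace α] {F H : α → ℝ} (h : BM F) (h' : BM H) :
    BM (fun x => F x * H x) := by
  obtain ⟨h1, C, hC⟩ := h
  obtain ⟨h1', C', hC'⟩ := h'
  refine ⟨h1.mul h1', C * C', fun x => ?_⟩
  rw [abs_mul]
  exact mul_le_mul (hC x) (hC' x) (abs_nonneg _) ((abs_nonneg _).trans (hC x))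

lemma BM.add {α : Type*} [MeasurableSpace α] {F H : α → ℝ} (h : BM F) (h' : BM H) :
    BM (fun x => F x + H x) := by
  obtain ⟨h1, C, hC⟩ := h
  obtain ⟨h1', C', hC'⟩ := h'
  exact ⟨h1.add h1', C + C', fun x => (abs_add_le _ _).trans (add_le_add (hC x) (hC' x))⟩

lemma BM.sub {α : Type*} [MeasurableSpace α] {F H : α → ℝ} (h : BM F) (h' : BM H) :
    BM (fun x => F x - H x) := by
  obtain ⟨h1, C, hC⟩ := h
  obtain ⟨h1', C', hC'⟩ := h'
  exact ⟨h1.sub h1', C + C', fun x => (abs_sub _ _).trans (add_le_add (hC x) (hC' x))⟩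

lemma BM.const {α : Type*} [MeasurableSpace α] (c : ℝ) : BM (fun _ : α => c) :=
  ⟨measurable_const, |c|, fun _ => le_rfl⟩

lemma BM.abs {α : Type*} [MeasurableSpace α] {F : α → ℝ} (h : BM F) : BM (fun x => |F x|) := by
  obtain ⟨h1, C, hC⟩ := h
  exact ⟨h1.abs, C, fun x => by simpa using hC x⟩

lemma BM.comp {α β : Type*} [MeasurableSpace α] [MeasurableSpace β] {F : α → ℝ} (h : BM F)
    {f : β → α} (hf : Measurable f) : BM (fun x => F (f x)) :=
  ⟨h.1.comp hf, h.2.imp fun _ hC _ => hC _⟩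

/-- Indicator of `a < b`. -/
def ltf (a b : ℝ) : ℝ := if a < b then 1 else 0

lemma ltf_nonneg (a b : ℝ) : 0 ≤ ltf a b := by unfold ltf; split_ifs <;> norm_num
lemma ltf_le_one (a b : ℝ) : ltf a b ≤ 1 := by unfold ltf; split_ifs <;> norm_num

lemma BM.ltf {α : Type*} [MeasurableSpace α] {f g : α → ℝ} (hf : Measurable f)
    (hg : Measurable g) : BM (fun x => ltf (f x) (g x)) :=
  ⟨Measurable.ite (measurableSet_lt hf hg) measurable_const measurable_const, 1, fun x => by
    rw [abs_of_nonneg (ltf_nonneg _ _)]; exact ltf_le_one _ _⟩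

/-- `e^{-|x|}`. -/
def ex (x : ℝ) : ℝ := Real.exp (-|x|)

lemma ex_pos (x : ℝ) : 0 < ex x := Real.exp_pos _
lemma ex_le_one (x : ℝ) : ex x ≤ 1 := by simp [ex]

lemma BM.ex {α : Type*} [MeasurableSpace α] {f : α → ℝ} (hf : Measurable f) :
    BM (fun x => ex (f x)) :=
  ⟨Real.measurable_exp.comp hf.abs.neg, 1, fun x => by
    rw [abs_of_nonneg (ex_pos _).le]; exact ex_le_one _⟩

lemma meas_upd (s : ℤ) : Measurable (fun p : ℝ × (ℤ → ℝ) => update p.2 s p.1) := by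
  rw [measurable_pi_iff]
  intro i
  by_cases h : i = s
  · subst h; simpa using measurable_fst
  · simp only [update_of_ne h]; fun_prop

section resample

lemma isProb {P : Measure (ℤ → ℝ)} (hP : IsUniformProduct P) : IsProbabilityMeasure P := ⟨by simpa using hP ∅ (fun _ => univ) (by simp)⟩

lemma eq_pi {P : Measure (ℤ → ℝ)} (hP : IsUniformProduct P) : P = Measure.infinitePi (fun _ : ℤ => nu) := by
  apply Measure.eq_infinitePi
  intro F A hA
  exact hP F A (fun i _ => hA i)

lemma resample_map {P : Measure (ℤ → ℝ)} (hP : IsUniformProduct P) (s : ℤ) : (nu.prod P).map (fun p => update p.2 s p.1) = P := by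
  have := isProb hP
  conv_rhs => rw [eq_pi hP]
  apply Measure.eq_infinitePi
  intro F A hA
  rw [Measure.map_apply (meas_upd s) (MeasurableSet.pi F.countable_toSet (fun i _ => hA i))]
  have : (fun p : ℝ × (ℤ → ℝ) => update p.2 s p.1) ⁻¹' ((F : Set ℤ).pi A) =
      (if s ∈ F then A s else univ) ×ˢ {T | ∀ i ∈ F.erase s, T i ∈ A i} := by
    ext ⟨u, T⟩
    simp only [mem_preimage, Set.mem_pi, Finset.mem_coe, mem_prod, Set.mem_ofPred_eq, Finset.mem_erase]
    constructor
    · intro h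
      refine ⟨?_, fun i hi => by simpa [hi.1] using h i hi.2⟩
      split_ifs with hs
      · simpa using h s hs
      · trivial
    · rintro ⟨h1, h2⟩ i hi
      by_cases his : i = s
      · subst his; simpa [hi] using h1
      · simpa [his] using h2 i ⟨his, hi⟩
  rw [this, Measure.prod_prod, hP _ _ (fun i _ => hA i)]
  split_ifs with hs
  · exact Finset.mul_prod_erase F (fun i => nu (A i)) hs
  · simp [Finset.erase_eq_of_notMem hs, nu]

lemma resample1 {P : Measure (ℤ → ℝ)} (hP : IsUniformProduct P) (s : ℤ) {F : (ℤ → ℝ) → ℝ} (hF : BM F) :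
    ∫ T, F T ∂P = ∫ u, ∫ T, F (update T s u) ∂P ∂nu := by
  have := isProb hP
  conv_lhs => rw [← resample_map hP s]
  rw [integral_map (meas_upd s).aemeasurable hF.1.aestronglyMeasurable,
    integral_prod _ ((hF.comp (meas_upd s)).integrable _)]

lemma resample2 {P : Measure (ℤ → ℝ)} (hP : IsUniformProduct P) (s : ℤ) {F : (ℤ → ℝ) → ℝ} (hF : BM F) :
    ∫ T, F T ∂P = ∫ T, ∫ u, F (update T s u) ∂nu ∂P := by
  have := isProb hP
  conv_lhs => rw [← resample_map hP s]
  rw [integral_map (meas_upd s).aemeasurable hF.1.aestronglyMeasurable,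
    integral_prod_symm _ ((hF.comp (meas_upd s)).integrable _)]

lemma ae_Ico {P : Measure (ℤ → ℝ)} (hP : IsUniformProduct P) (s : ℤ) : ∀ᵐ T ∂P, T s ∈ Ico (0 : ℝ) 1 := by
  have h := hP {s} (fun _ => (Ico (0 : ℝ) 1)ᶜ) (fun _ _ => measurableSet_Ico.compl)
  rw [ae_iff]
  convert h using 1
  · congr 1; ext T; simp
  · rw [Finset.prod_singleton, Measure.restrict_apply measurableSet_Ico.compl]
    symm
    refine measure_mono_null (t := {1}) ?_ (by simp)
    rintro x ⟨h1, h2⟩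
    simp at h1 h2 ⊢
    linarith [h1 h2.1]

lemma ae_ne {P : Measure (ℤ → ℝ)} (hP : IsUniformProduct P) {s s' : ℤ} (h : s ≠ s') : ∀ᵐ T ∂P, T s ≠ T s' := by
  have := isProb hP
  have hm : MeasurableSet {T : ℤ → ℝ | T s = T s'} :=
    measurableSet_eq_fun (measurable_pi_apply _) (measurable_pi_apply _)
  rw [ae_iff]
  simp only [not_not]
  rw [← resample_map hP s, Measure.map_apply (meas_upd s) hm,
    Measure.prod_apply_symm (meas_upd s hm)]
  rw [lintegral_eq_zero_of_ae_eq_zero]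
  refine Filter.Eventually.of_forall fun T => ?_
  have : (fun x => (x, T)) ⁻¹' ((fun p : ℝ × (ℤ → ℝ) => update p.2 s p.1) ⁻¹' {T | T s = T s'})
      = {T s'} := by
    ext u
    simp [update_of_ne h.symm]
  beta_reduce
  rw [this]
  simp [nu]

lemma ae_chain {P : Measure (ℤ → ℝ)} (hP : IsUniformProduct P) (s ε : ℤ) (hε : ε ≠ 0) :
    ∀ᵐ T ∂P, ∃ i : ℕ, ¬ (T (s + ε * (i + 1)) < T (s + ε * i)) := by
  have := isProb hP
  have h : ∀ᵐ T ∂P, ∀ q : ℚ, q < 1 → ∃ i : ℕ, (q : ℝ) ≤ T (s + ε * i) := by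
    rw [ae_all_iff]
    intro q
    by_cases hq : q < 1
    swap
    · simp [hq]
    simp only [hq, forall_const]
    rw [ae_iff]
    have key : ∀ n : ℕ, P {T | ¬ ∃ i : ℕ, (q : ℝ) ≤ T (s + ε * i)} ≤ (nu (Iio (q : ℝ))) ^ n := by
      intro n
      have h := hP ((Finset.range n).image (fun i : ℕ => s + ε * i)) (fun _ => Iio (q : ℝ))
        (fun _ _ => measurableSet_Iio)
      rw [Finset.prod_const, Finset.card_image_of_injective] at h
      · rw [Finset.card_range] at h
        rw [nu, ← h]
        apply measure_mono
        intro T hT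
        simp at hT ⊢
        intro i _
        exact hT i
      · intro a b hab
        simpa [hε] using hab
    have hlt : nu (Iio (q : ℝ)) < 1 := by
      have hq' : (q : ℝ) < 1 := by exact_mod_cast hq
      calc nu (Iio (q : ℝ)) ≤ volume (Ico (0 : ℝ) q) := by
            rw [nu, Measure.restrict_apply measurableSet_Iio]
            apply measure_mono
            rintro x ⟨h1, h2⟩
            exact ⟨h2.1, h1⟩
        _ < 1 := by simpa using hq'
    have := ENNReal.tendsto_pow_atTop_nhds_zero_of_lt_one hlt
    exact le_antisymm (ge_of_tendsto' this key) (zero_le)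
  filter_upwards [h, ae_Ico hP s] with T h1 h2
  by_contra hcon
  push Not at hcon
  obtain ⟨q, hq1, hq2⟩ := exists_rat_btwn h2.2
  have mono : ∀ i : ℕ, T (s + ε * i) ≤ T s := by
    intro i
    induction i with
    | zero => simp
    | succ i ih => 
      have := hcon i
      push_cast
      linarith
  obtain ⟨i, hi⟩ := h1 q (by exact_mod_cast hq2)
  linarith [mono i]

end resample

/-- The descending chain starting at `0` has even length. -/
def Ev (a : ℕ → ℝ) : Prop := ∃ k : ℕ, (∀ i : ℕ, i < 2 * k → a (i + 1) < a i) ∧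
  a (2 * k) < a (2 * k + 1)

lemma ev_iff_even {a : ℕ → ℝ} {N : ℕ} (h1 : ∀ i < N, a (i + 1) < a i) (h2 : a N < a (N + 1)) :
    Ev a ↔ Even N := by
  constructor
  · rintro ⟨k, hk1, hk2⟩
    have : N = 2 * k := by
      rcases lt_trichotomy N (2 * k) with h | h | h
      · exact absurd (hk1 N h) (not_lt.2 h2.le)
      · exact h
      · exact absurd (h1 _ h) (not_lt.2 hk2.le)
    exact ⟨k, by omega⟩
  · rintro ⟨k, hk⟩
    obtain rfl : N = 2 * k := by omega
    exact ⟨k, h1, h2⟩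

lemma ev_rec {a : ℕ → ℝ} (hne : ∀ i, a (i + 1) ≠ a i) (hex : ∃ i, ¬ a (i + 1) < a i) :
    Ev a ↔ ¬ (a 1 < a 0 ∧ Ev (fun i => a (i + 1))) := by
  classical
  obtain ⟨N, h1, h2⟩ : ∃ N, (∀ i < N, a (i + 1) < a i) ∧ a N < a (N + 1) := by
    refine ⟨Nat.find hex, fun i hi => ?_, ?_⟩
    · simpa using Nat.find_min hex hi
    · exact lt_of_le_of_ne (not_lt.1 (Nat.find_spec hex)) (hne _).symm
  rw [ev_iff_even h1 h2]
  cases N with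
  | zero => simp at h2; simp [h2.le]
  | succ M =>
    rw [ev_iff_even (a := fun i => a (i + 1)) (N := M) (fun i hi => h1 (i + 1) (by omega)) h2]
    have := h1 0 (by omega)
    simp at this
    simp [this, Nat.even_add_one]

/-- One-sided chain sequence. -/
def seqL (ε s : ℤ) (T : ℤ → ℝ) : ℕ → ℝ := fun i => T (s + ε * i)

open Classical in
/-- Indicator that the one-sided chain from `s` in direction `ε` is even. -/
def Lf (ε s : ℤ) (T : ℤ → ℝ) : ℝ := if Ev (seqL ε s T) then 1 else 0

lemma Lf_nonneg (ε s : ℤ) (T : ℤ → ℝ) : 0 ≤ Lf ε s T := by unfold Lf; split_ifs <;> norm_num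
lemma Lf_le_one (ε s : ℤ) (T : ℤ → ℝ) : Lf ε s T ≤ 1 := by unfold Lf; split_ifs <;> norm_num
lemma Lf_sq (ε s : ℤ) (T : ℤ → ℝ) : Lf ε s T * Lf ε s T = Lf ε s T := by
  unfold Lf; split_ifs <;> norm_num

lemma meas_Ev (ε s : ℤ) : MeasurableSet {T : ℤ → ℝ | Ev (seqL ε s T)} := by
  have h : {T : ℤ → ℝ | Ev (seqL ε s T)} = ⋃ k : ℕ, ((⋂ i : ℕ, ⋂ _ : i < 2 * k,
      {T : ℤ → ℝ | seqL ε s T (i + 1) < seqL ε s T i}) ∩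
        {T : ℤ → ℝ | seqL ε s T (2 * k) < seqL ε s T (2 * k + 1)}) := by
    ext T; simp [Ev]
  have hm : ∀ i, Measurable (fun T : ℤ → ℝ => seqL ε s T i) := fun i => measurable_pi_apply _
  rw [h]
  exact MeasurableSet.iUnion fun k => (MeasurableSet.iInter fun i => MeasurableSet.iInter fun _ =>
    measurableSet_lt (hm _) (hm _)).inter (measurableSet_lt (hm _) (hm _))

lemma BM_Lf (ε s : ℤ) : BM (Lf ε s) :=
  ⟨Measurable.ite (meas_Ev ε s) measurable_const measurable_const, 1, fun x => by
    rw [abs_of_nonneg (Lf_nonneg _ _ _)]; exact Lf_le_one _ _ _⟩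

lemma Lf_rec {ε s : ℤ} {T : ℤ → ℝ} (hne : ∀ i, seqL ε s T (i + 1) ≠ seqL ε s T i)
    (hex : ∃ i, ¬ seqL ε s T (i + 1) < seqL ε s T i) :
    Lf ε s T = 1 - ltf (T (s + ε)) (T s) * Lf ε (s + ε) T := by
  have h := ev_rec hne hex
  have h1 : (fun i => seqL ε s T (i + 1)) = seqL ε (s + ε) T := by
    ext i; simp only [seqL]; congr 1; push_cast; ring
  have h2 : seqL ε s T 1 = T (s + ε) := by simp [seqL]
  have h3 : seqL ε s T 0 = T s := by simp [seqL]
  rw [h1, h2, h3] at h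
  unfold Lf ltf
  by_cases c1 : T (s + ε) < T s <;> by_cases c2 : Ev (seqL ε (s + ε) T) <;> simp [h, c1, c2]

lemma Lf_upd {ε s i : ℤ} (h : ∀ j : ℕ, s + ε * j ≠ i) (T : ℤ → ℝ) (u : ℝ) :
    Lf ε s (update T i u) = Lf ε s T := by
  have : seqL ε s (update T i u) = seqL ε s T := by
    ext j; simp [seqL, update_of_ne (h j)]
  rw [Lf, Lf, this]

lemma O_indicator (t : ℝ) (s : ℤ) (T : ℤ → ℝ) :
    (O t s).indicator (fun _ => (1 : ℝ)) T = ltf (T s) t * (Lf (-1) s T * Lf 1 s T) := by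
  have : T ∈ O t s ↔ T s < t ∧ Ev (seqL (-1) s T) ∧ Ev (seqL 1 s T) := by
    simp only [O, mem_iUnion, G, Ev, seqL]
    have e1 : ∀ i : ℕ, s + -1 * ((i + 1 : ℕ) : ℤ) = s - i - 1 := fun i => by push_cast; ring
    have e2 : ∀ i : ℕ, s + -1 * ((i : ℕ) : ℤ) = s - i := fun i => by ring
    have e3 : ∀ i : ℕ, s + 1 * ((i + 1 : ℕ) : ℤ) = s + i + 1 := fun i => by push_cast; ring
    have e4 : ∀ i : ℕ, s + 1 * ((i : ℕ) : ℤ) = s + i := fun i => by ring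
    simp only [e1, e2, e3, e4]
    push_cast
    constructor
    · rintro ⟨j, k, h1, h2, h3, h4, h5⟩
      exact ⟨h1, ⟨j, h2, h3⟩, ⟨k, h4, h5⟩⟩
    · rintro ⟨h1, ⟨j, h2, h3⟩, ⟨k, h4, h5⟩⟩
      exact ⟨j, k, h1, h2, h3, h4, h5⟩
  classical
  rw [Set.indicator_apply]
  simp only [this]
  unfold ltf Lf
  by_cases c1 : T s < t <;> by_cases c2 : Ev (seqL (-1) s T) <;> by_cases c3 : Ev (seqL 1 s T) <;>
    simp [c1, c2, c3]

lemma meas_O (t : ℝ) (s : ℤ) : MeasurableSet (O t s) := by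
  have h : BM (fun T : ℤ → ℝ => ltf (T s) t * (Lf (-1) s T * Lf 1 s T)) :=
    (BM.ltf (measurable_pi_apply _) measurable_const).mul ((BM_Lf _ _).mul (BM_Lf _ _))
  have h2 : (O t s).indicator (fun _ => (1 : ℝ)) =
    (fun T : ℤ → ℝ => ltf (T s) t * (Lf (-1) s T * Lf 1 s T)) := funext (O_indicator t s)
  have h3 := h.1
  rw [← h2] at h3
  exact (measurable_indicator_const_iff (1 : ℝ)).1 h3

/-- integral against nu of a truncated function -/
lemma nu_ltf (f : ℝ → ℝ) {y : ℝ} (hy : y ∈ Icc (0 : ℝ) 1) :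
    ∫ u, ltf u y * f u ∂nu = ∫ u in (0 : ℝ)..y, f u := by
  rw [intervalIntegral.integral_of_le hy.1, integral_Ioc_eq_integral_Ioo,
    ← integral_indicator measurableSet_Ioo, nu, integral_Icc_eq_integral_Ioc,
    integral_Ioc_eq_integral_Ioo, ← integral_indicator measurableSet_Ioo]
  congr 1
  ext u
  by_cases h1 : 0 < u <;> by_cases h2 : u < y
  · have : u < 1 := h2.trans_le hy.2
    simp [Set.indicator_apply, ltf, h1, h2, this]
  all_goals simp [Set.indicator_apply, ltf, h1, h2]

section

lemma ae_rec {P : Measure (ℤ → ℝ)} (hP : IsUniformProduct P) (ε : ℤ) (hε : ε ≠ 0) :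
    ∀ᵐ T ∂P, ∀ s : ℤ, Lf ε s T = 1 - ltf (T (s + ε)) (T s) * Lf ε (s + ε) T := by
  rw [ae_all_iff]
  intro s
  have h1 : ∀ᵐ T ∂P, ∀ i : ℕ, T (s + ε * (i + 1)) ≠ T (s + ε * i) := by
    rw [ae_all_iff]
    intro i
    apply ae_ne hP
    intro h
    apply hε
    linarith
  filter_upwards [h1, ae_chain hP s ε hε] with T h1 h2
  apply Lf_rec
  · intro i; simpa [seqL] using h1 i
  · simpa [seqL] using h2

lemma L_step {P : Measure (ℤ → ℝ)} (hP : IsUniformProduct P) (ε : ℤ) (hε : ε ≠ 0) (m : ℕ) : ∀ (s : ℤ) (H : (ℤ → ℝ) → ℝ), BM H →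
    (∀ (i : ℕ) (T : ℤ → ℝ) (u : ℝ), H (update T (s + ε * (i + 1)) u) = H T) →
    |∫ T, (Lf ε s T - ex (T s)) * H T ∂P| ≤ ∫ T, |H T| * (min 1 |T s|) ^ m / (m.factorial : ℝ) ∂P := by
  have := isProb hP
  have bm1 : ∀ (m : ℕ), BM (fun x : ℝ => (min 1 |x|) ^ m / (m.factorial : ℝ)) := by
    intro m
    refine ⟨by fun_prop, 1, fun x => ?_⟩
    have h0 : 0 ≤ min 1 |x| := by positivity
    rw [abs_of_nonneg (by positivity)]
    apply div_le_one_of_le₀ _ (by positivity)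
    exact (pow_le_one₀ h0 (min_le_left _ _)).trans (by exact_mod_cast Nat.factorial_pos m)
  have bm : ∀ (m : ℕ) (s : ℤ), BM (fun T : ℤ → ℝ => (min 1 |T s|) ^ m / (m.factorial : ℝ)) :=
    fun m s => (bm1 m).comp (measurable_pi_apply s)
  have bx : ∀ s : ℤ, BM (fun T : ℤ → ℝ => ex (T s)) := fun s => BM.ex (measurable_pi_apply s)
  induction m with
  | zero =>
    intro s H hH _
    refine (abs_integral_le_integral_abs).trans ?_
    refine integral_mono ((((BM_Lf ε s).sub (bx s)).mul hH).abs.integrable _) ?_ ?_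
    · simpa using hH.abs.integrable P
    intro T
    simp only [pow_zero, Nat.factorial_zero, Nat.cast_one, abs_mul]
    have h1 : |Lf ε s T - ex (T s)| ≤ 1 := by
      rw [abs_le]
      constructor <;> linarith [Lf_nonneg ε s T, Lf_le_one ε s T, ex_pos (T s), ex_le_one (T s)]
    nlinarith [abs_nonneg (H T)]
  | succ m ih =>
    intro s H hH hdep
    have hne : s + ε ≠ s := by simpa using hε
    have bl : BM (fun T : ℤ → ℝ => ltf (T (s + ε)) (T s)) :=
      BM.ltf (measurable_pi_apply _) (measurable_pi_apply _)
    have hdep1 : ∀ T u, H (update T (s + ε) u) = H T := fun T u => by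
      simpa using hdep 0 T u
    have key : ∀ g : ℝ → ℝ, BM g → ∀ K : (ℤ → ℝ) → ℝ, BM K →
        (∀ T u, K (update T (s + ε) u) = K T) →
        ∫ T, g (T (s + ε)) * (ltf (T (s + ε)) (T s) * K T) ∂P =
          ∫ T, (∫ u in (0 : ℝ)..(T s), g u) * K T ∂P := by
      intro g hg K hK hdepK
      rw [resample2 hP (s + ε) ((hg.comp (measurable_pi_apply _)).mul (bl.mul hK))]
      apply integral_congr_ae
      filter_upwards [ae_Ico hP s] with T hT
      rw [← nu_ltf _ ⟨hT.1, hT.2.le⟩, ← integral_mul_const]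
      apply integral_congr_ae
      refine Filter.Eventually.of_forall fun u => ?_
      simp only [hdepK, update_self, update_of_ne hne.symm]
      ring
    have e1 : ∫ T, (Lf ε s T - ex (T s)) * H T ∂P =
        - ∫ T, (Lf ε (s + ε) T - ex (T (s + ε))) * (ltf (T (s + ε)) (T s) * H T) ∂P := by
      have a1 : ∫ T, Lf ε s T * H T ∂P = ∫ T, H T ∂P -
          ∫ T, Lf ε (s + ε) T * (ltf (T (s + ε)) (T s) * H T) ∂P := by
        rw [← integral_sub (hH.integrable _) (((BM_Lf _ _).mul (bl.mul hH)).integrable _)]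
        apply integral_congr_ae
        filter_upwards [ae_rec hP ε hε] with T hT
        rw [hT s]; ring
      have a2 : ∫ T, ex (T s) * H T ∂P = ∫ T, H T ∂P -
          ∫ T, ex (T (s + ε)) * (ltf (T (s + ε)) (T s) * H T) ∂P := by
        have a3 : ∫ T, (∫ u in (0 : ℝ)..(T s), ex u) * H T ∂P =
            ∫ T, (H T - ex (T s) * H T) ∂P := by
          apply integral_congr_ae
          filter_upwards [ae_Ico hP s] with T hT
          have : ∫ u in (0 : ℝ)..(T s), ex u = 1 - ex (T s) := by
            have : ∫ u in (0 : ℝ)..(T s), ex u = ∫ u in (0 : ℝ)..(T s), Real.exp (-u) := by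
              apply intervalIntegral.integral_congr
              intro u hu
              rw [uIcc_of_le hT.1] at hu
              simp [ex, abs_of_nonneg hu.1]
            rw [this]
            simp [ex, abs_of_nonneg hT.1]
          rw [this]; ring
        rw [key ex (BM.ex measurable_id) H hH hdep1, a3,
          integral_sub (hH.integrable _) (((bx s).mul hH).integrable _)]
        ring
      simp only [sub_mul]
      rw [integral_sub (((BM_Lf _ _).mul hH).integrable _) (((bx s).mul hH).integrable _),
        integral_sub (((BM_Lf _ _).mul (bl.mul hH)).integrable _)
          (((bx _).mul (bl.mul hH)).integrable _), a1, a2]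
      ring
    rw [e1, abs_neg]
    refine (ih (s + ε) _ (bl.mul hH) ?_).trans (le_of_eq ?_)
    · intro i T u
      have h1 : s + ε ≠ s + ε + ε * (i + 1) := by
        intro h
        have : ε * (i + 1) = 0 := by linarith
        rcases mul_eq_zero.1 this with h | h
        · exact hε h
        · omega
      have h2 : s ≠ s + ε + ε * (i + 1) := by
        intro h
        have : ε * (i + 2) = 0 := by linarith
        rcases mul_eq_zero.1 this with h | h
        · exact hε h
        · omega
      have h3 := hdep (i + 1) T u
      have h4 : s + ε * (((i + 1 : ℕ) : ℤ) + 1) = s + ε + ε * (i + 1) := by push_cast; ring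
      rw [h4] at h3
      simp only [update_of_ne h1, update_of_ne h2, h3]
    · have h := key _ (bm1 m) (fun T => |H T|) hH.abs (fun T u => by simp only [hdep1])
      trans ∫ T, (∫ u in (0 : ℝ)..(T s), (min 1 |u|) ^ m / (m.factorial : ℝ)) * |H T| ∂P
      · rw [← h]
        congr 1
        ext T
        rw [abs_mul, abs_of_nonneg (ltf_nonneg _ _)]
        ring
      · apply integral_congr_ae
        filter_upwards [ae_Ico hP s] with T hT
        have : ∫ u in (0 : ℝ)..(T s), (min 1 |u|) ^ m / (m.factorial : ℝ) =
            ∫ u in (0 : ℝ)..(T s), u ^ m / (m.factorial : ℝ) := by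
          apply intervalIntegral.integral_congr
          intro u hu
          rw [uIcc_of_le hT.1] at hu
          simp [abs_of_nonneg hu.1, min_eq_right (hu.2.trans hT.2.le)]
        rw [this, intervalIntegral.integral_div, integral_pow, abs_of_nonneg hT.1,
          min_eq_right hT.2.le, Nat.factorial_succ]
        push_cast
        field_simp
        simp

lemma L_out {P : Measure (ℤ → ℝ)} (hP : IsUniformProduct P) (ε : ℤ) (hε : ε ≠ 0) (s : ℤ) (H : (ℤ → ℝ) → ℝ) (hH : BM H)
    (hdep : ∀ (i : ℕ) (T : ℤ → ℝ) (u : ℝ), H (update T (s + ε * (i + 1)) u) = H T) :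
    ∫ T, Lf ε s T * H T ∂P = ∫ T, ex (T s) * H T ∂P := by
  have := isProb hP
  have bx : BM (fun T : ℤ → ℝ => ex (T s)) := BM.ex (measurable_pi_apply s)
  obtain ⟨C, hC⟩ := hH.2
  have hC0 : 0 ≤ C := (abs_nonneg _).trans (hC 0)
  have bd : ∀ m : ℕ, |∫ T, (Lf ε s T - ex (T s)) * H T ∂P| ≤ C * (1 ^ m / (m.factorial : ℝ)) := by
    intro m
    refine (L_step hP ε hε m s H hH hdep).trans ?_
    refine (integral_mono_of_nonneg (g := fun _ => C * (1 ^ m / (m.factorial : ℝ))) ?_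
      (integrable_const _) ?_).trans ?_
    · exact Filter.Eventually.of_forall fun T => by positivity
    · refine Filter.Eventually.of_forall fun T => ?_
      simp only [mul_div_assoc]
      gcongr
      · exact hC T
      · exact min_le_left _ _
    · simp
  have lim : Filter.Tendsto (fun m : ℕ => C * ((1 : ℝ) ^ m / (m.factorial : ℝ))) Filter.atTop
      (nhds 0) := by
    simpa using (FloorSemiring.tendsto_pow_div_factorial_atTop (1 : ℝ)).const_mul C
  have h0 := abs_nonpos_iff.1 (ge_of_tendsto' lim bd)
  simp only [sub_mul] at h0
  rw [integral_sub (((BM_Lf _ _).mul hH).integrable _) ((bx.mul hH).integrable _)] at h0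
  linarith

end

/-- Truncated exponential series of `e^{-s}`. -/
def Et (N : ℕ) (s : ℝ) : ℝ := ∑ i ∈ Finset.range N, (-s) ^ i / (i.factorial : ℝ)

/-- Power over factorial. -/
def pf (m : ℕ) (s : ℝ) : ℝ := s ^ m / (m.factorial : ℝ)

lemma Et_succ (N : ℕ) (s : ℝ) : Et (N + 1) s = Et N s + pf N (-s) := Finset.sum_range_succ _ _

lemma Et_zero (s : ℝ) : Et 0 s = 0 := by simp [Et]

lemma pf_zero (s : ℝ) : pf 0 s = 1 := by simp [pf]

lemma pf_at_zero (m : ℕ) : pf (m + 1) 0 = 0 := by simp [pf]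

lemma Et_at_zero (N : ℕ) : Et (N + 1) 0 = 1 := by
  induction N with
  | zero => simp [Et_succ, Et_zero, pf_zero]
  | succ N ih => rw [Et_succ, ih, neg_zero, pf_at_zero, add_zero]

lemma hd_pf (m : ℕ) (s : ℝ) : HasDerivAt (pf (m + 1)) (pf m s) s := by
  have h := (hasDerivAt_pow (m + 1) s).div_const ((m + 1).factorial : ℝ)
  refine HasDerivAt.congr_deriv (f := pf (m + 1)) h ?_
  unfold pf
  rw [Nat.factorial_succ]
  push_cast
  have : (m.factorial : ℝ) ≠ 0 := by positivity
  field_simp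

lemma hd_Et (N : ℕ) (s : ℝ) : HasDerivAt (Et (N + 1)) (-Et N s) s := by
  induction N with
  | zero =>
    have : Et (0 + 1) = fun _ => 1 := by ext s; simp [Et]
    rw [this, Et_zero, neg_zero]
    exact hasDerivAt_const _ _
  | succ N ih =>
    have h1 : Et (N + 1 + 1) = fun s => Et (N + 1) s + pf (N + 1) (-s) := by
      ext s; exact Et_succ _ _
    rw [h1, Et_succ N]
    have h2 := (hd_pf N (-s)).comp s (hasDerivAt_neg s)
    refine HasDerivAt.congr_deriv (ih.add h2) ?_
    ring

lemma cont_pf (m : ℕ) : Continuous (pf m) := by unfold pf; fun_prop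
lemma cont_Et (N : ℕ) : Continuous (Et N) := by unfold Et; fun_prop

/-- The explicit kernel. -/
def KK (m : ℕ) (x y : ℝ) : ℝ :=
  (Et (m + 1) (x + y) + Et m (x + y)) / 2 - pf m (-|x - y|) / 2

lemma cont_KK (m : ℕ) (x : ℝ) : Continuous (KK m x) := by
  unfold KK
  have := cont_pf m
  have := cont_Et m
  have := cont_Et (m + 1)
  fun_prop

lemma cont_KK2 (m : ℕ) : Continuous (fun p : ℝ × ℝ => KK m p.1 p.2) := by
  unfold KK
  have := cont_pf m
  have := cont_Et m
  have := cont_Et (m + 1)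
  fun_prop

lemma KK_zero (x y : ℝ) : KK 0 x y = 0 := by simp [KK, Et_succ, Et_zero, pf_zero]

/-- FTC helper -/
lemma ftc {f F : ℝ → ℝ} {a b : ℝ} (hab : a ≤ b) (hf : Continuous f)
    (h : ∀ z ∈ Icc a b, ∃ d, HasDerivAt F d z ∧ d = f z) :
    ∫ z in a..b, f z = F b - F a := by
  apply intervalIntegral.integral_eq_sub_of_hasDerivAt
  · intro z hz
    rw [uIcc_of_le hab] at hz
    obtain ⟨d, h1, h2⟩ := h z hz
    rwa [← h2]
  · exact hf.intervalIntegrable _ _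

lemma hd_th (m : ℕ) (x z : ℝ) :
    HasDerivAt (fun z => Et (m + 1) (x + z)) (-Et m (x + z)) z := by
  simpa using (hd_Et m (x + z)).comp_const_add x z

lemma hd_left (m : ℕ) (x z : ℝ) :
    HasDerivAt (fun z => pf (m + 1) (-(x - z))) (pf m (-(x - z))) z := by
  have h : HasDerivAt (fun z : ℝ => -(x - z)) 1 z := by
    exact (((hasDerivAt_id' z).const_sub x).neg).congr_deriv (by ring)
  exact ((hd_pf m (-(x - z))).comp z h).congr_deriv (by ring)

lemma hd_right (m : ℕ) (x z : ℝ) :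
    HasDerivAt (fun z => pf (m + 1) (-(z - x))) (-pf m (-(z - x))) z := by
  have h : HasDerivAt (fun z : ℝ => -(z - x)) (-1) z := by
    exact ((hasDerivAt_id' z).sub_const x).neg
  have h2 := (hd_pf m (-(z - x))).comp z h
  rw [mul_neg_one] at h2
  exact h2

lemma hd_exp (z : ℝ) : HasDerivAt (fun z : ℝ => Real.exp (-z)) (-Real.exp (-z)) z := by
  simpa using (hasDerivAt_neg z).exp

lemma hd_Etleft (m : ℕ) (x z : ℝ) :
    HasDerivAt (fun z => Et (m + 1) (x - z)) (Et m (x - z)) z := by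
  have h : HasDerivAt (fun z : ℝ => (x - z)) (-1) z := by
    exact ((hasDerivAt_id' z).const_sub x)
  exact ((hd_Et m (x - z)).comp z h).congr_deriv (by ring)

lemma KK_le {m : ℕ} {x y : ℝ} (h : y ≤ x) : KK m x y =
    (Et (m + 1) (x + y) + Et m (x + y)) / 2 - pf m (-(x - y)) / 2 := by
  rw [KK, abs_of_nonneg (by linarith)]

lemma KK_ge {m : ℕ} {x y : ℝ} (h : x ≤ y) : KK m x y =
    (Et (m + 1) (x + y) + Et m (x + y)) / 2 - pf m (-(y - x)) / 2 := by
  rw [KK, abs_sub_comm, abs_of_nonneg (by linarith)]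

lemma int_left (m : ℕ) {x y : ℝ} (hy : 0 ≤ y) (h : y ≤ x) :
    ∫ z in (0 : ℝ)..y, KK m x z =
      (-(Et (m + 2) (x + y) + Et (m + 1) (x + y)) / 2 - pf (m + 1) (-(x - y)) / 2) -
      (-(Et (m + 2) x + Et (m + 1) x) / 2 - pf (m + 1) (-x) / 2) := by
  have := ftc (F := fun y =>
    (-(Et (m + 2) (x + y) + Et (m + 1) (x + y)) / 2 - pf (m + 1) (-(x - y)) / 2)) hy
    (cont_KK m x) (fun z hz => ⟨_, (((hd_th (m + 1) x z).add (hd_th m x z)).neg.div_const 2).sub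
      ((hd_left m x z).div_const 2), by rw [KK_le (hz.2.trans h)]; ring⟩)
  simpa using this

lemma int_right (m : ℕ) {x y : ℝ} (h : x ≤ y) :
    ∫ z in x..y, KK m x z =
      (-(Et (m + 2) (x + y) + Et (m + 1) (x + y)) / 2 + pf (m + 1) (-(y - x)) / 2) -
      (-(Et (m + 2) (x + x) + Et (m + 1) (x + x)) / 2) := by
  have := ftc (F := fun y =>
    (-(Et (m + 2) (x + y) + Et (m + 1) (x + y)) / 2 + pf (m + 1) (-(y - x)) / 2)) h
    (cont_KK m x) (fun z hz => ⟨_, (((hd_th (m + 1) x z).add (hd_th m x z)).neg.div_const 2).add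
      ((hd_right m x z).div_const 2), by rw [KK_ge hz.1]; ring⟩)
  simpa [pf_at_zero] using this

lemma pf_neg (m : ℕ) (s : ℝ) : pf m (-s) = (-1) ^ m * pf m s := by
  rw [pf, pf, neg_pow]; ring

lemma KK_rec (m : ℕ) {x y : ℝ} (hx : 0 ≤ x) (hy : 0 ≤ y) :
    KK (m + 1) x y = Et (m + 2) x + (-1) ^ (m + 2) * (ltf y x * pf (m + 1) (x - y)) -
      ∫ z in (0 : ℝ)..y, KK m x z := by
  have e := Et_succ (m + 1) x
  rcases lt_or_ge y x with h | h
  · rw [int_left m hy h.le, KK_le h.le, ltf, if_pos h]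
    have := pf_neg (m + 1) (x - y)
    rw [e, this]
    ring
  · rw [← intervalIntegral.integral_add_adjacent_intervals
      ((cont_KK m x).intervalIntegrable 0 x) ((cont_KK m x).intervalIntegrable x y),
      int_left m hx le_rfl, int_right m h, KK_ge h, ltf, if_neg (not_lt.2 h), e]
    simp [pf_at_zero]
    ring

lemma finA (m : ℕ) {x t : ℝ} (hx : 0 ≤ x) (hxt : x ≤ t) :
    ∫ y in (0 : ℝ)..t, Real.exp (-y) * (KK m x y + KK (m + 1) x y) =
      Real.exp (-x) - Real.exp (-t) * KK (m + 1) x t := by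
  have hc : Continuous (fun y => Real.exp (-y) * (KK m x y + KK (m + 1) x y)) := by
    have := cont_KK m x
    have := cont_KK (m + 1) x
    fun_prop
  have h1 := ftc (F := fun y => -(Real.exp (-y) * ((Et (m + 2) (x + y) + Et (m + 1) (x + y)) / 2)) +
    Real.exp (-y) * ((Et (m + 1) (x - y) + Et (m + 2) (x - y)) / 2)) hx hc
    (fun z hz => ⟨_, (((hd_exp z).mul (((hd_th (m + 1) x z).add (hd_th m x z)).div_const 2)).neg).add
      ((hd_exp z).mul (((hd_Etleft m x z).add (hd_Etleft (m + 1) x z)).div_const 2)), by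
        rw [KK_le hz.2, KK_le hz.2]
        have e1 := Et_succ (m + 1) (x - z)
        have e2 := Et_succ m (x - z)
        simp only [Pi.add_apply]
        rw [e1, e2]
        ring⟩)
  have h2 := ftc (F := fun y => -(Real.exp (-y) * ((Et (m + 2) (x + y) + Et (m + 1) (x + y)) / 2)) +
    Real.exp (-y) * (pf (m + 1) (-(y - x)) / 2)) hxt hc
    (fun z hz => ⟨_, (((hd_exp z).mul (((hd_th (m + 1) x z).add (hd_th m x z)).div_const 2)).neg).add
      ((hd_exp z).mul ((hd_right m x z).div_const 2)), by
        rw [KK_ge hz.1, KK_ge hz.1]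
        simp only [Pi.add_apply]
        ring⟩)
  rw [← intervalIntegral.integral_add_adjacent_intervals
      (hc.intervalIntegrable 0 x) (hc.intervalIntegrable x t), h1, h2, KK_ge hxt]
  have z2 := Et_at_zero (m + 1)
  simp [pf_at_zero, Et_at_zero]
  ring_nf at z2 ⊢

lemma finB (m : ℕ) {t : ℝ} (ht : 0 ≤ t) :
    ∫ x in (0 : ℝ)..t, Real.exp (-x) * KK (m + 1) x t =
      Real.exp (-t) * (1 - Et (m + 2) (2 * t)) / 2 := by
  have hc : Continuous (fun x => Real.exp (-x) * KK (m + 1) x t) := by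
    have := (cont_KK2 (m + 1)).comp (Continuous.prodMk_left t)
    exact (Real.continuous_exp.comp continuous_neg).mul this
  have h1 := ftc (F := fun x => -(Real.exp (-x) * (Et (m + 2) (t + x) / 2)) +
    Real.exp (-x) * (Et (m + 2) (t - x) / 2)) ht hc
    (fun z hz => ⟨_, (((hd_exp z).mul ((hd_th (m + 1) t z).div_const 2)).neg).add
      ((hd_exp z).mul ((hd_Etleft (m + 1) t z).div_const 2)), by
        rw [KK_ge hz.2]
        have e1 := Et_succ (m + 1) (t - z)
        rw [e1, add_comm z t]
        ring⟩)
  rw [h1]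
  have z2 := Et_at_zero (m + 1)
  simp only [sub_self, z2, sub_zero, add_zero, ← two_mul]
  ring

/-- Indicator of a decreasing run of length `m` from the origin. -/
def Dn : ℕ → (ℤ → ℝ) → ℝ
  | 0, _ => 1
  | m + 1, T => Dn m T * ltf (T ((m + 1 : ℕ) : ℤ)) (T (m : ℤ))

/-- Truncated alternating sum. -/
def Xn : ℕ → (ℤ → ℝ) → ℝ
  | 0, _ => 1
  | n + 1, T => Xn n T + (-1) ^ (n + 1) * Dn (n + 1) T

/-- Backward recursion. -/
def Yn : ℕ → (ℤ → ℝ) → ℝ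
  | 0, _ => 1
  | n + 1, T => 1 - ltf (T (n : ℤ)) (T ((n + 1 : ℕ) : ℤ)) * Yn n T

lemma BM_Dn (m : ℕ) : BM (Dn m) := by
  induction m with
  | zero => exact BM.const 1
  | succ m ih => exact ih.mul (BM.ltf (measurable_pi_apply _) (measurable_pi_apply _))

lemma BM_Xn (m : ℕ) : BM (Xn m) := by
  induction m with
  | zero => exact BM.const 1
  | succ m ih => exact ih.add ((BM.const _).mul (BM_Dn (m + 1)))

lemma BM_Yn (m : ℕ) : BM (Yn m) := by
  induction m with
  | zero => exact BM.const 1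
  | succ m ih =>
    exact (BM.const 1).sub ((BM.ltf (measurable_pi_apply _) (measurable_pi_apply _)).mul ih)

lemma Dn_congr {m : ℕ} {T T' : ℤ → ℝ} (h : ∀ j : ℕ, j ≤ m → T j = T' j) : Dn m T = Dn m T' := by
  induction m with
  | zero => rfl
  | succ m ih =>
    rw [Dn, Dn, ih (fun j hj => h j (by omega)), h m (by omega), h (m + 1) le_rfl]

lemma Xn_congr {m : ℕ} {T T' : ℤ → ℝ} (h : ∀ j : ℕ, j ≤ m → T j = T' j) : Xn m T = Xn m T' := by
  induction m with
  | zero => rfl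
  | succ m ih => rw [Xn, Xn, ih (fun j hj => h j (by omega)), Dn_congr h]

lemma Yn_congr {m : ℕ} {T T' : ℤ → ℝ} (h : ∀ j : ℕ, j ≤ m → T j = T' j) : Yn m T = Yn m T' := by
  induction m with
  | zero => rfl
  | succ m ih =>
    rw [Yn, Yn, ih (fun j hj => h j (by omega)), h m (by omega), h (m + 1) le_rfl]

lemma XY_key (n : ℕ) (T : ℤ → ℝ) : Xn (n + 1) T * Yn (n + 1) T =
    Xn (n + 1) T - ltf (T (n : ℤ)) (T ((n + 1 : ℕ) : ℤ)) * (Xn n T * Yn n T) := by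
  have : Dn (n + 1) T * ltf (T (n : ℤ)) (T ((n + 1 : ℕ) : ℤ)) = 0 := by
    rw [Dn, mul_assoc]
    convert mul_zero _
    unfold ltf
    split_ifs with h1 h2 <;> simp
    exact absurd (h1.trans h2) (lt_irrefl _)
  rw [Yn, Xn]
  linear_combination (-(-1) ^ (n + 1) * Yn n T) * this

lemma ae_nu (x : ℝ) : ∀ᵐ u ∂nu, u ∈ Icc (0 : ℝ) 1 ∧ u ≠ x := by
  refine Filter.Eventually.and (ae_restrict_mem measurableSet_Icc) ?_
  refine ae_restrict_of_ae ?_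
  simp [ae_iff]

/-- Doubly updated configuration. -/
def UU (n : ℕ) (x y : ℝ) (T : ℤ → ℝ) : ℤ → ℝ := update (update T 0 x) (n : ℤ) y

lemma meas_up1 (s : ℤ) (x : ℝ) : Measurable (fun T : ℤ → ℝ => update T s x) :=
  (meas_upd s).comp (measurable_const.prodMk measurable_id)

lemma meas_UU (n : ℕ) (x y : ℝ) : Measurable (UU n x y) := (meas_up1 _ y).comp (meas_up1 _ x)

lemma cont_sub_pf (m : ℕ) (x : ℝ) : Continuous (fun u => pf m (x - u)) :=
  (cont_pf m).comp (continuous_const.sub continuous_id)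

lemma int_pf (m : ℕ) {x y : ℝ} (hy : 0 ≤ y) :
    ∫ u in (0 : ℝ)..y, pf m (x - u) = pf (m + 1) x - pf (m + 1) (x - y) := by
  have h1 := ftc (F := fun u => -pf (m + 1) (x - u)) hy (cont_sub_pf m x) (fun z _ => by
    have h : HasDerivAt (fun z : ℝ => (x - z)) (-1) z := (hasDerivAt_id' z).const_sub x
    exact ⟨_, ((hd_pf m (x - z)).comp z h).neg, by ring⟩)
  rw [h1, sub_zero]; ring

section

lemma delta2 {P : Measure (ℤ → ℝ)} (hP : IsUniformProduct P) (m : ℕ) {x : ℝ} (hx : x ∈ Icc (0 : ℝ) 1) : ∀ y ∈ Icc (0 : ℝ) 1,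
    ∫ T, Dn (m + 1) (UU (m + 1) x y T) ∂P = ltf y x * pf m (x - y) := by
  have := isProb hP
  induction m with
  | zero =>
    intro y hy
    have : ∀ T, Dn (0 + 1) (UU (0 + 1) x y T) = ltf y x := by
      intro T; simp [Dn, UU, update_apply]
    simp [this, pf_zero]
  | succ m ih =>
    intro y hy
    rw [resample1 hP ((m + 1 : ℕ) : ℤ) ((BM_Dn _).comp (meas_UU _ x y))]
    have e : ∀ u T, Dn (m + 1 + 1) (UU (m + 1 + 1) x y (update T ((m + 1 : ℕ) : ℤ) u)) =
        Dn (m + 1) (UU (m + 1) x u T) * ltf y u := by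
      intro u T
      rw [Dn]
      congr 1
      · apply Dn_congr
        intro j hj
        simp only [UU, update_apply]
        grind
      · simp only [UU, update_apply]
        grind
    simp only [e, integral_mul_const]
    have e2 : ∫ u, (∫ T, Dn (m + 1) (UU (m + 1) x u T) ∂P) * ltf y u ∂nu =
        ∫ u, ltf y x * (ltf u x * pf m (x - u) - ltf u y * pf m (x - u)) ∂nu := by
      apply integral_congr_ae
      filter_upwards [ae_nu y] with u hu
      rw [ih u hu.1]
      have := hu.2
      unfold ltf
      grind
    have bi : ∀ z ∈ Icc (0 : ℝ) 1, Integrable (fun u => ltf u z * pf m (x - u)) nu := by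
      intro z hz
      refine Integrable.bdd_mul (c := 1) ?_ (BM.ltf measurable_id measurable_const).1.aestronglyMeasurable ?_
      · exact (cont_sub_pf m x).integrableOn_Icc
      · exact Filter.Eventually.of_forall fun u => by
          rw [Real.norm_eq_abs, abs_of_nonneg (ltf_nonneg _ _)]; exact ltf_le_one _ _
    rw [e2, integral_const_mul, integral_sub (bi x hx) (bi y hy), nu_ltf _ hx, nu_ltf _ hy,
      int_pf m hx.1, int_pf m hy.1, sub_self, pf_at_zero]
    ring

lemma delta1 {P : Measure (ℤ → ℝ)} (hP : IsUniformProduct P) (m : ℕ) {x : ℝ} (hx : x ∈ Icc (0 : ℝ) 1) :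
    ∫ T, Dn m (update T 0 x) ∂P = pf m x := by
  have := isProb hP
  cases m with
  | zero => simp [Dn, pf_zero]
  | succ m =>
    rw [resample1 hP ((m + 1 : ℕ) : ℤ) ((BM_Dn _).comp (meas_up1 _ x))]
    have e : ∀ u T, Dn (m + 1) (update (update T ((m + 1 : ℕ) : ℤ) u) 0 x) =
        Dn (m + 1) (UU (m + 1) x u T) := by
      intro u T
      apply Dn_congr
      intro j hj
      simp only [UU, update_apply]
      grind
    simp only [e]
    have e2 : ∫ u, (∫ T, Dn (m + 1) (UU (m + 1) x u T) ∂P) ∂nu =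
        ∫ u, ltf u x * pf m (x - u) ∂nu := by
      apply integral_congr_ae
      filter_upwards [ae_nu x] with u hu
      rw [delta2 hP m hx u hu.1]
    rw [e2, nu_ltf _ hx, int_pf m hx.1, sub_self, pf_at_zero, sub_zero]

lemma xi1 {P : Measure (ℤ → ℝ)} (hP : IsUniformProduct P) (n : ℕ) {x : ℝ} (hx : x ∈ Icc (0 : ℝ) 1) :
    ∫ T, Xn n (update T 0 x) ∂P = Et (n + 1) x := by
  have := isProb hP
  induction n with
  | zero => simp [Xn, Et_succ, Et_zero, pf_zero]
  | succ n ih =>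
    simp only [Xn]
    rw [integral_add (((BM_Xn n).comp (meas_up1 0 x)).integrable P)
      (((BM.const _).mul ((BM_Dn (n + 1)).comp (meas_up1 0 x))).integrable P), ih,
      integral_const_mul, delta1 hP _ hx, Et_succ (n + 1), pf_neg]

lemma xi2 {P : Measure (ℤ → ℝ)} (hP : IsUniformProduct P) (n : ℕ) {x y : ℝ} (hx : x ∈ Icc (0 : ℝ) 1) (hy : y ∈ Icc (0 : ℝ) 1) :
    ∫ T, Xn (n + 1) (UU (n + 1) x y T) ∂P =
      Et (n + 1) x + (-1) ^ (n + 1) * (ltf y x * pf n (x - y)) := by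
  have := isProb hP
  simp only [Xn]
  rw [integral_add (((BM_Xn n).comp (meas_UU _ x y)).integrable P)
      (((BM.const _).mul ((BM_Dn (n + 1)).comp (meas_UU _ x y))).integrable P),
      integral_const_mul, delta2 hP _ hx _ hy, ← xi1 hP n hx]
  congr 2
  ext T
  apply Xn_congr
  intro j hj
  simp only [UU, update_apply]
  grind

lemma kernel {P : Measure (ℤ → ℝ)} (hP : IsUniformProduct P) (m : ℕ) {x : ℝ} (hx : x ∈ Icc (0 : ℝ) 1) : ∀ y ∈ Icc (0 : ℝ) 1, y ≠ x →
    ∫ T, Xn (m + 1) (UU (m + 1) x y T) * Yn (m + 1) (UU (m + 1) x y T) ∂P = KK m x y := by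
  have := isProb hP
  induction m with
  | zero =>
    intro y hy hxy
    have : ∀ T, Xn (0 + 1) (UU (0 + 1) x y T) * Yn (0 + 1) (UU (0 + 1) x y T) = 0 := by
      intro T
      simp [Xn, Yn, Dn, UU, update_apply, ltf]
      grind
    simp [this, KK_zero]
  | succ m ih =>
    intro y hy hxy
    have bX := (BM_Xn (m + 2)).comp (meas_UU (m + 2) x y)
    have bR : BM (fun T : ℤ → ℝ => ltf (T ((m + 1 : ℕ) : ℤ)) y *
        (Xn (m + 1) (update T 0 x) * Yn (m + 1) (update T 0 x))) :=
      (BM.ltf (measurable_pi_apply _) measurable_const).mul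
        (((BM_Xn _).comp (meas_up1 0 x)).mul ((BM_Yn _).comp (meas_up1 0 x)))
    have e : ∀ T, Xn (m + 1 + 1) (UU (m + 1 + 1) x y T) * Yn (m + 1 + 1) (UU (m + 1 + 1) x y T) =
        Xn (m + 2) (UU (m + 2) x y T) - ltf (T ((m + 1 : ℕ) : ℤ)) y *
        (Xn (m + 1) (update T 0 x) * Yn (m + 1) (update T 0 x)) := by
      intro T
      rw [XY_key]
      have c : ∀ j : ℕ, j ≤ m + 1 → UU (m + 1 + 1) x y T j = update T 0 x j := by
        intro j hj
        simp only [UU, update_apply]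
        grind
      rw [Xn_congr c, Yn_congr c, c _ le_rfl]
      congr 2
      simp only [UU, update_apply]
      grind
    simp only [e]
    rw [integral_sub (bX.integrable P) (bR.integrable P), xi2 hP (m + 1) hx hy,
      KK_rec m hx.1 hy.1, resample1 hP ((m + 1 : ℕ) : ℤ) bR]
    have e1 : ∀ u T, ltf (update T ((m + 1 : ℕ) : ℤ) u ((m + 1 : ℕ) : ℤ)) y *
        (Xn (m + 1) (update (update T ((m + 1 : ℕ) : ℤ) u) 0 x) *
          Yn (m + 1) (update (update T ((m + 1 : ℕ) : ℤ) u) 0 x)) =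
        ltf u y * (Xn (m + 1) (UU (m + 1) x u T) * Yn (m + 1) (UU (m + 1) x u T)) := by
      intro u T
      rw [update_self, UU, update_comm (by positivity)]
    simp only [e1, integral_const_mul]
    rw [← nu_ltf _ hy]
    congr 1
    apply integral_congr_ae
    filter_upwards [ae_nu x] with u hu
    rw [ih u hu.1 hu.2]

end

section

lemma single {P : Measure (ℤ → ℝ)} (hP : IsUniformProduct P) (t : ℝ) (ht : t ∈ Icc (0 : ℝ) 1) (s : ℤ) :
    (P (O t s)).toReal = (1 - Real.exp (-t) * Real.exp (-t)) / 2 := by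
  have := isProb hP
  have h0 : (P (O t s)).toReal = ∫ T, ltf (T s) t * (Lf (-1) s T * Lf 1 s T) ∂P := by
    simp only [← O_indicator]
    rw [integral_indicator_const _ (meas_O t s)]
    simp [Measure.real]
  have bl : BM (fun T : ℤ → ℝ => ltf (T s) t) := BM.ltf (measurable_pi_apply _) measurable_const
  have be : BM (fun T : ℤ → ℝ => ex (T s)) := BM.ex (measurable_pi_apply _)
  have h1 := L_out hP (-1) (by norm_num) s (fun T => ltf (T s) t * Lf 1 s T)
    (bl.mul (BM_Lf _ _)) (by
      intro i T u
      rw [update_of_ne (by omega), Lf_upd (by intro j; omega)])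
  have h2 := L_out hP 1 (by norm_num) s (fun T => ex (T s) * ltf (T s) t)
    (be.mul bl) (by
      intro i T u
      rw [update_of_ne (by omega)])
  have e1 : ∀ T, ltf (T s) t * (Lf (-1) s T * Lf 1 s T) = Lf (-1) s T * (ltf (T s) t * Lf 1 s T) :=
    fun T => by ring
  have e2 : ∀ T, ex (T s) * (ltf (T s) t * Lf 1 s T) = Lf 1 s T * (ex (T s) * ltf (T s) t) :=
    fun T => by ring
  simp only [h0, e1, h1, e2, h2]
  rw [resample1 hP s (be.mul (be.mul bl))]
  simp only [update_self, integral_const, probReal_univ, one_smul]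
  have e3 : ∀ u, ex u * (ex u * ltf u t) = ltf u t * (ex u * ex u) := fun u => by ring
  simp only [e3]
  rw [nu_ltf _ ht]
  have e4 : ∫ u in (0 : ℝ)..t, ex u * ex u = ∫ u in (0 : ℝ)..t, Real.exp (-u) * Real.exp (-u) := by
    apply intervalIntegral.integral_congr
    intro u hu
    rw [uIcc_of_le ht.1] at hu
    simp only [ex, abs_of_nonneg hu.1]
  have h3 := ftc (F := fun u => -(Real.exp (-u) * Real.exp (-u)) / 2)
    (f := fun u => Real.exp (-u) * Real.exp (-u)) ht.1 (by fun_prop)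
    (fun z _ => ⟨_, ((hd_exp z).mul (hd_exp z)).neg.div_const 2, by ring⟩)
  rw [e4, h3]
  simp
  ring

lemma ae_X {P : Measure (ℤ → ℝ)} (hP : IsUniformProduct P) (n : ℕ) : ∀ᵐ T ∂P, Lf 1 0 T * Lf 1 n T = Xn n T * Lf 1 n T := by
  filter_upwards [ae_rec hP 1 (by norm_num)] with T hT
  have key : Lf 1 0 T = Xn n T - (-1) ^ n * Dn n T * (1 - Lf 1 n T) := by
    induction n with
    | zero => simp [Xn, Dn]
    | succ n ih =>
      have h := hT n
      rw [ih, h, Xn, Dn]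
      push_cast
      ring
  rw [key]
  linear_combination ((-1) ^ n * Dn n T) * Lf_sq 1 n T

lemma ae_Y {P : Measure (ℤ → ℝ)} (hP : IsUniformProduct P) (n : ℕ) : ∀ᵐ T ∂P, Lf (-1) n T * Lf (-1) 0 T = Yn n T * Lf (-1) 0 T := by
  filter_upwards [ae_rec hP (-1) (by norm_num)] with T hT
  induction n with
  | zero => simpa [Yn] using Lf_sq (-1) 0 T
  | succ n ih =>
    have h := hT ((n + 1 : ℕ) : ℤ)
    have e : ((n + 1 : ℕ) : ℤ) + -1 = n := by push_cast; ring
    rw [e] at h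
    rw [h, Yn]
    linear_combination (-ltf (T n) (T ((n + 1 : ℕ) : ℤ))) * ih

lemma pair {P : Measure (ℤ → ℝ)} (hP : IsUniformProduct P) (m : ℕ) (t : ℝ) (ht : t ∈ Icc (0 : ℝ) 1) :
    (P (O t 0 ∩ O t ((m + 1 : ℕ) : ℤ))).toReal =
      ∫ x in (0 : ℝ)..t, Real.exp (-x) * ∫ y in (0 : ℝ)..t, Real.exp (-y) * KK m x y := by
  have := isProb hP
  set n : ℤ := ((m + 1 : ℕ) : ℤ) with hn
  have hn1 : n = m + 1 := by rw [hn]; push_cast; ring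
  have bl : ∀ s, BM (fun T : ℤ → ℝ => ltf (T s) t) := fun s =>
    BM.ltf (measurable_pi_apply _) measurable_const
  have be : ∀ s, BM (fun T : ℤ → ℝ => ex (T s)) := fun s => BM.ex (measurable_pi_apply _)
  have bXY : BM (fun T => Xn (m + 1) T * Yn (m + 1) T) := (BM_Xn _).mul (BM_Yn _)
  have h0 : (P (O t 0 ∩ O t n)).toReal = ∫ T, (ltf (T 0) t * (Lf (-1) 0 T * Lf 1 0 T)) *
      (ltf (T n) t * (Lf (-1) n T * Lf 1 n T)) ∂P := by
    simp only [← O_indicator]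
    rw [← measureReal_def, ← integral_indicator_one ((meas_O t 0).inter (meas_O t n))]
    congr 1
    ext T
    by_cases h1 : T ∈ O t 0 <;> by_cases h2 : T ∈ O t n <;> simp [h1, h2]
  have h1 : ∫ T, (ltf (T 0) t * (Lf (-1) 0 T * Lf 1 0 T)) *
      (ltf (T n) t * (Lf (-1) n T * Lf 1 n T)) ∂P =
      ∫ T, Lf (-1) 0 T * (Lf 1 n T * ((ltf (T 0) t * ltf (T n) t) *
        (Xn (m + 1) T * Yn (m + 1) T))) ∂P := by
    apply integral_congr_ae
    filter_upwards [ae_X hP (m + 1), ae_Y hP (m + 1)] with T hX hY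
    rw [← hn] at hX hY
    linear_combination (ltf (T 0) t * ltf (T n) t) * (Lf (-1) n T * Lf (-1) 0 T * hX +
      Xn (m + 1) T * Lf 1 n T * hY)
  have h2 := L_out hP (-1) (by norm_num) 0 (fun T => Lf 1 n T * ((ltf (T 0) t * ltf (T n) t) *
        (Xn (m + 1) T * Yn (m + 1) T)))
    ((BM_Lf _ _).mul (((bl 0).mul (bl n)).mul bXY)) (by
      intro i T u
      have c : ∀ j : ℕ, j ≤ m + 1 → update T (0 + -1 * ((i : ℤ) + 1)) u j = T j := by
        intro j hj
        rw [update_of_ne (by omega)]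
      rw [update_of_ne (by omega), update_of_ne (by omega), Lf_upd (by intro j; omega),
        Xn_congr c, Yn_congr c])
  have h3 := L_out hP 1 (by norm_num) n (fun T => ex (T 0) * ((ltf (T 0) t * ltf (T n) t) *
        (Xn (m + 1) T * Yn (m + 1) T)))
    ((be 0).mul (((bl 0).mul (bl n)).mul bXY)) (by
      intro i T u
      have c : ∀ j : ℕ, j ≤ m + 1 → update T (n + 1 * ((i : ℤ) + 1)) u j = T j := by
        intro j hj
        rw [update_of_ne (by omega)]
      rw [update_of_ne (by omega), update_of_ne (by omega), Xn_congr c, Yn_congr c])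
  have e2 : ∀ T, ex (T 0) * (Lf 1 n T * ((ltf (T 0) t * ltf (T n) t) *
        (Xn (m + 1) T * Yn (m + 1) T))) = Lf 1 n T * (ex (T 0) * ((ltf (T 0) t * ltf (T n) t) *
        (Xn (m + 1) T * Yn (m + 1) T))) := fun T => by ring
  have bF := (be n).mul ((be 0).mul (((bl 0).mul (bl n)).mul bXY))
  rw [h0, h1, h2]
  simp only [e2]
  rw [h3, resample1 hP 0 bF]
  have inner : ∀ x ∈ Icc (0 : ℝ) 1, ∫ T, ex (update T 0 x n) * (ex (update T 0 x 0) *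
      ((ltf (update T 0 x 0) t * ltf (update T 0 x n) t) *
        (Xn (m + 1) (update T 0 x) * Yn (m + 1) (update T 0 x)))) ∂P =
      ltf x t * (ex x * ∫ y in (0 : ℝ)..t, ex y * KK m x y) := by
    intro x hx
    rw [resample1 hP n (bF.comp (meas_up1 0 x)), ← nu_ltf _ ht, ← integral_const_mul,
      ← integral_const_mul]
    apply integral_congr_ae
    filter_upwards [ae_nu x] with y hy
    rw [← kernel hP m hx y hy.1 hy.2, ← integral_const_mul, ← integral_const_mul,
      ← integral_const_mul, ← integral_const_mul]
    congr 1
    ext T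
    have c : update (update T n y) 0 x = UU (m + 1) x y T := by
      rw [UU, update_comm (by omega)]
    have c0 : UU (m + 1) x y T 0 = x := by
      rw [UU, update_of_ne (by omega), update_self]
    have c1 : UU (m + 1) x y T n = y := by
      rw [UU, update_self]
    rw [c, c0, c1]
    ring
  have e5 : ∫ x, (∫ T, ex (update T 0 x n) * (ex (update T 0 x 0) *
      ((ltf (update T 0 x 0) t * ltf (update T 0 x n) t) *
        (Xn (m + 1) (update T 0 x) * Yn (m + 1) (update T 0 x)))) ∂P) ∂nu =
      ∫ x, ltf x t * (ex x * ∫ y in (0 : ℝ)..t, ex y * KK m x y) ∂nu := by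
    apply integral_congr_ae
    filter_upwards [ae_nu 0] with x hx
    exact inner x hx.1
  rw [e5, nu_ltf _ ht]
  apply intervalIntegral.integral_congr
  intro x hx
  rw [uIcc_of_le ht.1] at hx
  simp only [ex, abs_of_nonneg hx.1]
  congr 1
  apply intervalIntegral.integral_congr
  intro y hy
  rw [uIcc_of_le ht.1] at hy
  simp only [abs_of_nonneg hy.1]

end

lemma cont_inner (m : ℕ) (t : ℝ) :
    Continuous (fun x => Real.exp (-x) * ∫ y in (0 : ℝ)..t, Real.exp (-y) * KK m x y) := by
  have h := cont_KK2 m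
  have h2 : Continuous (fun x => ∫ y in (0 : ℝ)..t, Real.exp (-y) * KK m x y) := by
    apply intervalIntegral.continuous_parametric_intervalIntegral_of_continuous'
    simp only [Function.uncurry_def]
    fun_prop
  fun_prop

lemma pair_sum (m : ℕ) (t : ℝ) (ht : 0 ≤ t) :
    (∫ x in (0 : ℝ)..t, Real.exp (-x) * ∫ y in (0 : ℝ)..t, Real.exp (-y) * KK m x y) +
    (∫ x in (0 : ℝ)..t, Real.exp (-x) * ∫ y in (0 : ℝ)..t, Real.exp (-y) * KK (m + 1) x y) =
      (1 - Real.exp (-t) * Real.exp (-t)) / 2 -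
      Real.exp (-t) * (Real.exp (-t) * (1 - Et (m + 2) (2 * t)) / 2) := by
  rw [← intervalIntegral.integral_add ((cont_inner m t).intervalIntegrable _ _)
    ((cont_inner (m + 1) t).intervalIntegrable _ _), ← finB m ht]
  have h3 := ftc (F := fun u => -(Real.exp (-u) * Real.exp (-u)) / 2)
    (f := fun u => Real.exp (-u) * Real.exp (-u)) ht (by fun_prop)
    (fun z _ => ⟨_, ((hd_exp z).mul (hd_exp z)).neg.div_const 2, by ring⟩)
  have h4 : (1 - Real.exp (-t) * Real.exp (-t)) / 2 =
      ∫ u in (0 : ℝ)..t, Real.exp (-u) * Real.exp (-u) := by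
    rw [h3]; simp; ring
  have hc : Continuous (fun x => Real.exp (-x) * KK (m + 1) x t) := by
    have := (cont_KK2 (m + 1)).comp (Continuous.prodMk_left t)
    exact (Real.continuous_exp.comp continuous_neg).mul this
  have hc2 : Continuous (fun x => Real.exp (-t) * (Real.exp (-x) * KK (m + 1) x t)) :=
    continuous_const.mul hc
  rw [h4, ← intervalIntegral.integral_const_mul, ← intervalIntegral.integral_sub
    (Continuous.intervalIntegrable (by fun_prop) _ _)
    (hc2.intervalIntegrable _ _)]
  apply intervalIntegral.integral_congr
  intro x hx
  rw [uIcc_of_le ht] at hx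
  have hA := finA m hx.1 hx.2
  have k1 := cont_KK m x
  have k2 := cont_KK (m + 1) x
  simp only [mul_add] at hA
  rw [intervalIntegral.integral_add (Continuous.intervalIntegrable (by fun_prop) _ _)
    (Continuous.intervalIntegrable (by fun_prop) _ _)] at hA
  simp only
  linear_combination Real.exp (-x) * hA

lemma exp_tail (N : ℕ) (s : ℝ) :
    ∑' n : ℕ, (-s) ^ (n + N) / ((n + N).factorial : ℝ) = Real.exp (-s) - Et N s := by
  have h := NormedSpace.expSeries_div_hasSum_exp (𝔸 := ℝ) (-s)
  have h2 := h.summable.sum_add_tsum_nat_add N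
  rw [h.tsum_eq, ← Real.exp_eq_exp_ℝ] at h2
  rw [← h2, Et]
  ring

end

theorem correlation_sum (P : Measure (ℤ → ℝ)) (hP : IsUniformProduct P)
    (t : ℝ) (ht : t ∈ Icc (0 : ℝ) 1) (r : ℕ) (hr : 2 ≤ r) (hre : Even r) :
    ((P (O t 0 ∩ O t (r + 1))).toReal - (P (O t 0)).toReal * (P (O t (r + 1))).toReal) +
      ((P (O t 0 ∩ O t r)).toReal - (P (O t 0)).toReal * (P (O t r)).toReal) =
      -(1 / 2) * Real.exp (-2 * t) *
        ∑' n : ℕ, (-2 * t) ^ (n + r + 1) / (Nat.factorial (n + r + 1)) := by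
  obtain ⟨m, rfl⟩ : ∃ m, r = m + 1 := ⟨r - 1, by omega⟩
  have p1 := pair hP m t ht
  have p2 := pair hP (m + 1) t ht
  have c2 : (((m + 1 + 1 : ℕ)) : ℤ) = ((m + 1 : ℕ) : ℤ) + 1 := by push_cast; ring
  rw [c2] at p2
  have hs := pair_sum m t ht.1
  have htail := exp_tail (m + 2) (2 * t)
  have e1 : ∑' n : ℕ, (-2 * t) ^ (n + (m + 1) + 1) / (Nat.factorial (n + (m + 1) + 1) : ℝ) =
      Real.exp (-(2 * t)) - Et (m + 2) (2 * t) := by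
    rw [← htail]
    congr 1
    ext n
    rw [neg_mul]
    rfl
  have e2 : Real.exp (-(2 * t)) = Real.exp (-t) * Real.exp (-t) := by
    rw [← Real.exp_add]; congr 1; ring
  rw [e1, neg_mul 2 t, p1, p2, single hP t ht, single hP t ht, single hP t ht, e2]
  linear_combination hs
end

section
/- For every t ∈ [0,1] and every even integer s ≥ 2, γ_{s,3}(t) := ℙ(D_s(t) ∩ M_3(t)) = (1−t)(e^{−t} − 1 + t) e^{−t} ∑_{i=0}^{s/2−1} t^{2i+1}/(2i+1)!. -/
open MeasureTheory Set

/-- The event that sites `-1` and `0` are vacant and site `s` is occupied at time `t`. -/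
def D (t : ℝ) (s : ℤ) : Set (ℤ → ℝ) := (O t (-1))ᶜ ∩ (O t 0)ᶜ ∩ O t s

def M1 (t : ℝ) : Set (ℤ → ℝ) := {T | t < T (-1) ∧ t < T 0}
def M2 (t : ℝ) : Set (ℤ → ℝ) := {T | T (-1) < t ∧ T 0 < t}
def M3 (t : ℝ) : Set (ℤ → ℝ) := {T | T (-1) < t ∧ t < T 0}
def M4 (t : ℝ) : Set (ℤ → ℝ) := {T | T 0 < t ∧ t < T (-1)}

open ProbabilityTheory Filter Topology

/-- the uniform measure on `[0,1]` -/
noncomputable def lam : Measure ℝ := volume.restrict (Icc (0 : ℝ) 1)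

instance : IsProbabilityMeasure lam := ⟨by simp [lam]⟩

/-- the iid uniform sequence -/
noncomputable def Q : Measure (ℕ → ℝ) := Measure.infinitePi (fun _ : ℕ => lam)

instance : IsProbabilityMeasure Q := by unfold Q; infer_instance

/-- chain started at `x` decreasing for exactly `n` steps -/
def Ex : ℕ → ℝ → (ℕ → ℝ) → Prop
  | 0, x, a => x < a 0
  | n + 1, x, a => a 0 < x ∧ Ex n (a 0) (fun i => a (i + 1))

lemma lint_aux (F F' : ℝ → ℝ) (hF : ∀ y, HasDerivAt F (F' y) y) (hc : Continuous F')
    (x : ℝ) (hx : x ∈ Icc (0 : ℝ) 1) (hn : ∀ y ∈ Icc (0 : ℝ) 1, 0 ≤ F' y)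
    (H : ℝ → ENNReal) (hH : ∀ y ∈ Icc (0 : ℝ) 1, H y = if y < x then ENNReal.ofReal (F' y) else 0) :
    ∫⁻ y, H y ∂lam = ENNReal.ofReal (F x - F 0) := by
  have h1 : ∫⁻ y, H y ∂lam =
      ∫⁻ y in Icc (0 : ℝ) 1, (Iio x).indicator (fun y => ENNReal.ofReal (F' y)) y := by
    unfold lam
    refine setLIntegral_congr_fun measurableSet_Icc (fun y hy => ?_)
    rw [hH y hy]; simp [indicator]
  rw [h1, lintegral_indicator measurableSet_Iio, Measure.restrict_restrict measurableSet_Iio]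
  have h2 : Iio x ∩ Icc (0 : ℝ) 1 = Ico 0 x := by
    ext y; simp only [mem_inter_iff, mem_Iio, mem_Icc, mem_Ico]
    have := hx.2
    constructor
    · rintro ⟨a, b, c⟩; exact ⟨b, a⟩
    · rintro ⟨a, b⟩; exact ⟨b, a, by linarith⟩
  rw [h2, restrict_Ico_eq_restrict_Ioc, ← ofReal_integral_eq_lintegral_ofReal,
    ← intervalIntegral.integral_of_le hx.1,
    intervalIntegral.integral_eq_sub_of_hasDerivAt (fun y _ => hF y) (hc.intervalIntegrable _ _)]
  · exact (hc.integrableOn_Icc).mono_set Ioc_subset_Icc_self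
  · filter_upwards [ae_restrict_mem measurableSet_Ioc] with y hy
    exact hn y ⟨hy.1.le, hy.2.trans hx.2⟩

/-- probability of exactly `n` descents from `x` -/
noncomputable def ee (n : ℕ) (x : ℝ) : ℝ :=
  x ^ n / n.factorial - x ^ (n + 1) / (n + 1).factorial

lemma pow_deriv (n : ℕ) (y : ℝ) :
    HasDerivAt (fun y : ℝ => y ^ (n + 1) / (n + 1).factorial) (y ^ n / n.factorial) y := by
  have := (hasDerivAt_pow (n + 1) y).div_const ((n + 1).factorial : ℝ)
  convert! this using 1
  rw [Nat.factorial_succ]; push_cast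
  have : (n.factorial : ℝ) ≠ 0 := by positivity
  have : (n : ℝ) + 1 ≠ 0 := by positivity
  field_simp
  try simp

lemma ee_deriv (n : ℕ) (y : ℝ) : HasDerivAt (ee (n + 1)) (ee n y) y :=
  (pow_deriv n y).sub (pow_deriv (n + 1) y)

lemma ee_nonneg (n : ℕ) (x : ℝ) (hx : x ∈ Icc (0 : ℝ) 1) : 0 ≤ ee n x := by
  unfold ee
  rw [Nat.factorial_succ, pow_succ]; push_cast
  have h0 : (0 : ℝ) < n.factorial := by positivity
  have h1 : 0 ≤ x ^ n := pow_nonneg hx.1 n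
  rw [sub_nonneg, div_le_div_iff₀ (by positivity) h0]
  have : x ≤ n + 1 := by have := hx.2; have : (0 : ℝ) ≤ n := by positivity
                         linarith
  calc x ^ n * x * n.factorial = (x ^ n * n.factorial) * x := by ring
    _ ≤ (x ^ n * n.factorial) * (n + 1) := by gcongr
    _ = _ := by ring

lemma ee_cont (n : ℕ) : Continuous (ee n) := by unfold ee; fun_prop

/-- sigma-algebra generated by coordinates in `S` -/
def sg {ι : Type*} (S : Set ι) : MeasurableSpace (ι → ℝ) :=
  ⨆ i ∈ S, MeasurableSpace.comap (fun T : ι → ℝ => T i) inferInstance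

lemma sg_le {ι : Type*} (S : Set ι) : sg S ≤ (inferInstance : MeasurableSpace (ι → ℝ)) :=
  iSup₂_le fun i _ => (measurable_pi_apply i).comap_le

lemma sg_eval {ι : Type*} {S : Set ι} {i : ι} (hi : i ∈ S) :
    Measurable[sg S] (fun T : ι → ℝ => T i) := by
  rw [measurable_iff_comap_le]
  exact le_iSup₂_of_le (f := fun i (_ : i ∈ S) =>
    MeasurableSpace.comap (fun T : ι → ℝ => T i) inferInstance) i hi le_rfl

lemma sg_indep {ι : Type*} {S S' : Set ι} (h : Disjoint S S') :
    Indep (sg S) (sg S') (Measure.infinitePi (fun _ : ι => lam)) :=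
  indep_iSup_of_disjoint (fun i => (measurable_pi_apply i).comap_le)
    (iIndepFun_infinitePi (P := fun _ : ι => lam) (X := fun _ => id) (fun _ => measurable_id)) h

lemma sg_indepFun {ι β γ : Type*} [MeasurableSpace β] [MeasurableSpace γ] {S S' : Set ι}
    (h : Disjoint S S') {f : (ι → ℝ) → β} {g : (ι → ℝ) → γ}
    (hf : Measurable[sg S] f) (hg : Measurable[sg S'] g) :
    IndepFun f g (Measure.infinitePi (fun _ : ι => lam)) :=
  indep_of_indep_of_le_left (indep_of_indep_of_le_right (sg_indep h) hg.comap_le) hf.comap_le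

lemma sg_map {ι : Type*} (f : ℕ → ι) (hf : Function.Injective f) :
    (Measure.infinitePi (fun _ : ι => lam)).map (fun T i => T (f i)) = Q := by
  exact Measure.map_infinitePi_infinitePi_of_inj (P := fun _ : ι => lam) hf

lemma sg_prod {ι : Type*} (i : ι) (f : ℕ → ι) (hf : Function.Injective f) (hi : ∀ n, f n ≠ i) :
    (Measure.infinitePi (fun _ : ι => lam)).map (fun T => (T i, fun n => T (f n))) =
      lam.prod Q := by
  have h := sg_indepFun (ι := ι) (S := {i}) (S' := range f)
    (by rw [Set.disjoint_singleton_left]; rintro ⟨n, hn⟩; exact hi n hn)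
    (f := fun T => T i) (g := fun T n => T (f n)) (sg_eval rfl)
    (@measurable_pi_iff _ _ _ (sg _) _ _ |>.2 fun n => sg_eval ⟨n, rfl⟩)
  rw [indepFun_iff_map_prod_eq_prod_map_map (Measurable.aemeasurable (by fun_prop)) (Measurable.aemeasurable (by fun_prop))] at h
  rw [h, sg_map f hf, Measure.infinitePi_map_eval (fun _ : ι => lam) i]

lemma sg_prod3 {ι : Type*} (i : ι) (f g : ℕ → ι) (hf : Function.Injective f)
    (hg : Function.Injective g) (hi : ∀ n, f n ≠ i) (hi' : ∀ n, g n ≠ i) 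
    (hfg : ∀ n m, f n ≠ g m) :
    (Measure.infinitePi (fun _ : ι => lam)).map
      (fun T => (T i, (fun n => T (f n), fun n => T (g n)))) = lam.prod (Q.prod Q) := by
  have h := sg_indepFun (ι := ι) (S := {i}) (S' := range f ∪ range g)
    (by rw [Set.disjoint_singleton_left]; rintro (⟨n, hn⟩ | ⟨n, hn⟩)
        exacts [hi n hn, hi' n hn])
    (f := fun T => T i) (g := fun T => (fun n => T (f n), fun n => T (g n))) (sg_eval rfl)
    (Measurable.prodMk
      (@measurable_pi_iff _ _ _ (sg _) _ _ |>.2 fun n => sg_eval (Or.inl ⟨n, rfl⟩))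
      (@measurable_pi_iff _ _ _ (sg _) _ _ |>.2 fun n => sg_eval (Or.inr ⟨n, rfl⟩)))
  have h' := sg_indepFun (ι := ι) (S := range f) (S' := range g)
    (by rw [Set.disjoint_left]; rintro _ ⟨n, rfl⟩ ⟨m, hm⟩; exact hfg n m hm.symm)
    (f := fun T n => T (f n)) (g := fun T n => T (g n)) 
      (@measurable_pi_iff _ _ _ (sg _) _ _ |>.2 fun n => sg_eval ⟨n, rfl⟩)
      (@measurable_pi_iff _ _ _ (sg _) _ _ |>.2 fun n => sg_eval ⟨n, rfl⟩)
  rw [indepFun_iff_map_prod_eq_prod_map_map (Measurable.aemeasurable (by fun_prop)) (Measurable.aemeasurable (by fun_prop))] at h'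
  rw [indepFun_iff_map_prod_eq_prod_map_map (Measurable.aemeasurable (by fun_prop))
    (Measurable.aemeasurable (by fun_prop))] at h
  rw [h, h', sg_map f hf, sg_map g hg, Measure.infinitePi_map_eval (fun _ : ι => lam) i]

lemma Ex_meas' {α : Type*} {mα : MeasurableSpace α} (n : ℕ) :
    ∀ (X : α → ℝ) (A : α → ℕ → ℝ), Measurable X → (∀ i ≤ n, Measurable fun w => A w i) →
      MeasurableSet {w | Ex n (X w) (A w)} := by
  induction n with
  | zero =>
    intro X A hX hA
    exact measurableSet_lt hX (hA 0 le_rfl)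
  | succ n ih =>
    intro X A hX hA
    exact (measurableSet_lt (hA 0 (Nat.zero_le _)) hX).inter
      (ih (fun w => A w 0) (fun w i => A w (i + 1)) (hA 0 (Nat.zero_le _))
        (fun i hi => hA (i + 1) (by omega)))

lemma Ex_meas {α : Type*} {mα : MeasurableSpace α} (n : ℕ)
    (X : α → ℝ) (A : α → ℕ → ℝ) (hX : Measurable X) (hA : Measurable A) :
      MeasurableSet {w | Ex n (X w) (A w)} :=
  Ex_meas' n X A hX (fun i _ => by fun_prop)

lemma Q_Ex (n : ℕ) : ∀ x ∈ Icc (0 : ℝ) 1, Q {a | Ex n x a} = ENNReal.ofReal (ee n x) := by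
  induction n with
  | zero =>
    intro x hx
    have : Q {a | Ex 0 x a} = lam (Ioi x) := by
      rw [← Measure.infinitePi_map_eval (fun _ : ℕ => lam) 0,
        Measure.map_apply (by fun_prop) measurableSet_Ioi]
      rfl
    rw [this, lam, Measure.restrict_apply measurableSet_Ioi]
    have : Ioi x ∩ Icc 0 1 = Ioc x 1 := by
      ext y; simp only [mem_inter_iff, mem_Ioi, mem_Icc, mem_Ioc]
      have := hx.1
      constructor
      · rintro ⟨a, b, c⟩; exact ⟨a, c⟩
      · rintro ⟨a, b⟩; exact ⟨a, by linarith, b⟩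
    rw [this, Real.volume_Ioc]
    simp [ee]
  | succ n ih =>
    intro x hx
    have hm : MeasurableSet {p : ℝ × (ℕ → ℝ) | p.1 < x ∧ Ex n p.1 p.2} :=
      (measurableSet_lt measurable_fst measurable_const).inter
        (Ex_meas n (fun p : ℝ × (ℕ → ℝ) => p.1) (fun p => p.2) measurable_fst measurable_snd)
    have : Q {a | Ex (n + 1) x a} = (lam.prod Q) {p | p.1 < x ∧ Ex n p.1 p.2} := by
      rw [← sg_prod (0 : ℕ) (fun n => n + 1) (fun a b h => by simpa using h) (fun n => by simp),
        Measure.map_apply (by fun_prop) hm]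
      rfl
    rw [this, Measure.prod_apply hm, lint_aux (ee (n + 1)) (ee n) (ee_deriv n) (ee_cont n) x hx
      (ee_nonneg n)]
    · simp [ee]
    · intro y hy
      split_ifs with h
      · rw [← ih y hy]; simp [h]
      · simp [h]

lemma Ex_iff (n : ℕ) : ∀ (x : ℝ) (a : ℕ → ℝ) (c : ℕ → ℝ), c 0 = x → (∀ i, c (i + 1) = a i) →
    (Ex n x a ↔ (∀ i < n, c (i + 1) < c i) ∧ c n < c (n + 1)) := by
  induction n with
  | zero => 
    intro x a c h0 h1
    simp [Ex, h0, h1]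
  | succ n ih =>
    intro x a c h0 h1
    have := ih (a 0) (fun i => a (i + 1)) (fun i => c (i + 1)) (h1 0) (fun i => h1 (i + 1))
    simp only [Ex, this, Nat.forall_lt_succ_left, and_assoc]
    rw [← h1 0, ← h0]

lemma Ex_unique (n : ℕ) : ∀ (m : ℕ) (x : ℝ) (a : ℕ → ℝ), Ex n x a → Ex m x a → n = m := by
  induction n with
  | zero => 
    intro m x a h h'
    cases m with
    | zero => rfl
    | succ m => exact absurd h (not_lt.2 h'.1.le)
  | succ n ih =>
    intro m x a h h'
    cases m with
    | zero => exact absurd h' (not_lt.2 h.1.le)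
    | succ m => rw [ih m _ _ h.2 h'.2]

lemma ee_sum (J : ℕ) (x : ℝ) : ∑ j ∈ Finset.range J, ee (2 * j) x =
    ∑ i ∈ Finset.range (2 * J), (-x) ^ i / i.factorial := by
  induction J with
  | zero => simp
  | succ J ih =>
    rw [Finset.sum_range_succ, ih, show 2 * (J + 1) = 2 * J + 1 + 1 by ring,
      Finset.sum_range_succ, Finset.sum_range_succ]
    simp only [ee]
    rw [(even_two_mul J).neg_pow, (even_two_mul J).add_one.neg_pow]
    ring

lemma ee_hasSum (x : ℝ) (hx : x ∈ Icc (0 : ℝ) 1) :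
    HasSum (fun j => ee (2 * j) x) (Real.exp (-x)) := by
  rw [hasSum_iff_tendsto_nat_of_nonneg (fun j => ee_nonneg _ x hx)]
  simp_rw [ee_sum]
  have h := (NormedSpace.exp_series_hasSum_exp' (𝕂 := ℝ) (-x)).tendsto_sum_nat
  rw [← Real.exp_eq_exp_ℝ] at h
  simp only [smul_eq_mul, inv_mul_eq_div] at h
  exact h.comp (tendsto_id.const_mul_atTop' (by norm_num : 0 < 2))

lemma Q_fin (J : ℕ) (x : ℝ) (hx : x ∈ Icc (0 : ℝ) 1) :
    Q {a | ∃ j < J, Ex (2 * j) x a} =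
      ENNReal.ofReal (∑ i ∈ Finset.range (2 * J), (-x) ^ i / i.factorial) := by
  have : {a | ∃ j < J, Ex (2 * j) x a} = ⋃ j ∈ Finset.range J, {a | Ex (2 * j) x a} := by
    ext; simp
  rw [this, measure_biUnion_finset, ← ee_sum, ENNReal.ofReal_sum_of_nonneg]
  · exact Finset.sum_congr rfl fun j _ => Q_Ex _ x hx
  · exact fun j _ => ee_nonneg _ x hx
  · intro i _ j _ hij
    refine Set.disjoint_left.2 fun a h h' => hij ?_
    have := Ex_unique _ _ _ _ h h'
    omega
  · exact fun j _ => Ex_meas _ _ _ (by fun_prop) (by fun_prop)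

lemma Q_inf (x : ℝ) (hx : x ∈ Icc (0 : ℝ) 1) :
    Q {a | ∃ j, Ex (2 * j) x a} = ENNReal.ofReal (Real.exp (-x)) := by
  have : {a | ∃ j, Ex (2 * j) x a} = ⋃ j, {a | Ex (2 * j) x a} := by
    ext; simp
  rw [this, measure_iUnion, ← (ee_hasSum x hx).tsum_eq, ENNReal.ofReal_tsum_of_nonneg]
  · exact tsum_congr fun j => Q_Ex _ x hx
  · exact fun j => ee_nonneg _ x hx
  · exact (ee_hasSum x hx).summable
  · intro i j hij
    refine Set.disjoint_left.2 fun a h h' => hij ?_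
    have := Ex_unique _ _ _ _ h h'
    omega
  · exact fun j => Ex_meas _ _ _ (by fun_prop) (by fun_prop)

lemma P_eq (P : Measure (ℤ → ℝ)) (hP : IsUniformProduct P) :
    P = Measure.infinitePi (fun _ : ℤ => lam) := by
  refine Measure.eq_infinitePi _ fun F A hA => ?_
  have := hP F A (fun i _ => hA i)
  exact this

lemma G_iff (t : ℝ) (s : ℤ) (j k : ℕ) (T : ℤ → ℝ) : T ∈ G t s j k ↔
    T s < t ∧ Ex (2 * j) (T s) (fun i => T (s - 1 - i)) ∧
      Ex (2 * k) (T s) (fun i => T (s + 1 + i)) := by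
  rw [Ex_iff (2 * j) (T s) (fun i => T (s - 1 - i)) (fun i : ℕ => T (s - i)) (by simp)
    (fun i => by congr 1; push_cast; ring),
    Ex_iff (2 * k) (T s) (fun i => T (s + 1 + i)) (fun i : ℕ => T (s + i)) (by simp)
    (fun i => by congr 1; push_cast; ring)]
  simp only [G, mem_ofPred_eq, and_assoc]
  push_cast
  simp only [sub_sub, add_assoc]

/-- the left part of the event -/
def EA (t : ℝ) : Set (ℤ → ℝ) :=
  {T | T (-1) < t ∧ ¬ ∃ j, Ex (2 * j) (T (-1)) (fun i => T (-1 - 1 - i))}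

/-- the right part of the event -/
def EC (t : ℝ) (s : ℤ) (J : ℕ) : Set (ℤ → ℝ) :=
  {T | T s < t ∧ (∃ j < J, Ex (2 * j) (T s) (fun i => T (s - 1 - i))) ∧
    ∃ k, Ex (2 * k) (T s) (fun i => T (s + 1 + i))}

lemma mem_O (t : ℝ) (s : ℤ) (T : ℤ → ℝ) : T ∈ O t s ↔ 
    T s < t ∧ (∃ j, Ex (2 * j) (T s) (fun i => T (s - 1 - i))) ∧
    ∃ k, Ex (2 * k) (T s) (fun i => T (s + 1 + i)) := by
  simp only [O, mem_iUnion, G_iff]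
  constructor
  · rintro ⟨j, k, a, b, c⟩; exact ⟨a, ⟨j, b⟩, ⟨k, c⟩⟩
  · rintro ⟨a, ⟨j, b⟩, ⟨k, c⟩⟩; exact ⟨j, k, a, b, c⟩

lemma Ex_lt (n : ℕ) : ∀ (x : ℝ) (a : ℕ → ℝ), Ex n x a → ∀ i < n, a i < x := by
  induction n with
  | zero => intro x a _ i hi; omega
  | succ n ih =>
    intro x a h i hi
    cases i with
    | zero => exact h.1
    | succ i => exact (ih _ _ h.2 i (by omega)).trans h.1

lemma event_eq (t : ℝ) (J : ℕ) (hJ : 1 ≤ J) :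
    D t ((2 * J : ℕ) : ℤ) ∩ M3 t = EA t ∩ ({T | t < T 0} ∩ EC t ((2 * J : ℕ) : ℤ) J) := by
  ext T
  simp only [D, M3, EA, EC, mem_inter_iff, mem_compl_iff, mem_O, mem_ofPred_eq]
  constructor
  · rintro ⟨⟨⟨h1, h2⟩, h3, ⟨j, h4⟩, h5⟩, h6, h7⟩
    refine ⟨⟨h6, fun h => h1 ⟨h6, h, 0, ?_⟩⟩, h7, h3, ⟨j, ?_, h4⟩, h5⟩
    · simp only [Ex]
      simp
      linarith
    · by_contra hj
      have := Ex_lt _ _ _ h4 (2 * J - 1) (by omega)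
      have e : (((2 * J : ℕ) : ℤ) - 1 - ((2 * J - 1 : ℕ) : ℤ)) = 0 := by omega
      rw [e] at this
      linarith
  · rintro ⟨⟨h6, h⟩, h7, h3, ⟨j, hj, h4⟩, h5⟩
    refine ⟨⟨⟨fun h' => h h'.2.1, fun h' => ?_⟩, h3, ⟨j, h4⟩, h5⟩, h6, h7⟩
    linarith [h'.1]

lemma EA_meas (t : ℝ) : MeasurableSet[sg (Iio (0 : ℤ))] (EA t) := by
  have h1 : Measurable[sg (Iio (0 : ℤ))] (fun T : ℤ → ℝ => T (-1)) := sg_eval (by simp)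
  refine MeasurableSet.inter (measurableSet_lt h1 measurable_const) (MeasurableSet.compl ?_)
  have : {T : ℤ → ℝ | ∃ j, Ex (2 * j) (T (-1)) (fun i => T (-1 - 1 - i))} =
    ⋃ j, {T : ℤ → ℝ | Ex (2 * j) (T (-1)) (fun i => T (-1 - 1 - i))} := by ext; simp
  change MeasurableSet[sg _] (Set.ofPred _)
  rw [this]
  refine MeasurableSet.iUnion fun j => ?_
  exact Ex_meas' _ _ _ h1 (fun i _ => sg_eval (by simp only [mem_Iio]; omega))

lemma EC_meas (t : ℝ) (J : ℕ) (hJ : 1 ≤ J) :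
    MeasurableSet[sg (Ioi (0 : ℤ))] (EC t ((2 * J : ℕ) : ℤ) J) := by
  have h1 : Measurable[sg (Ioi (0 : ℤ))] (fun T : ℤ → ℝ => T ((2 * J : ℕ) : ℤ)) :=
    sg_eval (by simp only [mem_Ioi]; omega)
  refine MeasurableSet.inter (measurableSet_lt h1 measurable_const) (MeasurableSet.inter ?_ ?_)
  · have : {T : ℤ → ℝ | ∃ j < J, Ex (2 * j) (T ((2 * J : ℕ) : ℤ))
        (fun i => T (((2 * J : ℕ) : ℤ) - 1 - i))} =
      ⋃ j : ℕ, ⋃ _ : j < J, {T : ℤ → ℝ | Ex (2 * j) (T ((2 * J : ℕ) : ℤ))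
        (fun i => T (((2 * J : ℕ) : ℤ) - 1 - i))} := by ext; simp
    change MeasurableSet[sg _] (Set.ofPred _)
    rw [this]
    refine MeasurableSet.iUnion fun j => MeasurableSet.iUnion fun hj => ?_
    exact Ex_meas' _ _ _ h1 (fun i _ => sg_eval (by simp only [mem_Ioi]; omega))
  · have : {T : ℤ → ℝ | ∃ k, Ex (2 * k) (T ((2 * J : ℕ) : ℤ))
        (fun i => T (((2 * J : ℕ) : ℤ) + 1 + i))} =
      ⋃ k : ℕ, {T : ℤ → ℝ | Ex (2 * k) (T ((2 * J : ℕ) : ℤ))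
        (fun i => T (((2 * J : ℕ) : ℤ) + 1 + i))} := by ext; simp
    change MeasurableSet[sg _] (Set.ofPred _)
    rw [this]
    refine MeasurableSet.iUnion fun j => ?_
    exact Ex_meas' _ _ _ h1 (fun i _ => sg_eval (by simp only [mem_Ioi]; omega))

lemma inf_meas {α : Type*} {mα : MeasurableSpace α} (X : α → ℝ) (A : α → ℕ → ℝ)
    (hX : Measurable X) (hA : Measurable A) : MeasurableSet {w | ∃ j, Ex (2 * j) (X w) (A w)} := by
  have : {w | ∃ j, Ex (2 * j) (X w) (A w)} = ⋃ j, {w | Ex (2 * j) (X w) (A w)} := by ext; simp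
  exact this ▸ MeasurableSet.iUnion fun j => Ex_meas _ _ _ hX hA

lemma fin_meas {α : Type*} {mα : MeasurableSpace α} (J : ℕ) (X : α → ℝ) (A : α → ℕ → ℝ)
    (hX : Measurable X) (hA : Measurable A) :
    MeasurableSet {w | ∃ j < J, Ex (2 * j) (X w) (A w)} := by
  have : {w | ∃ j < J, Ex (2 * j) (X w) (A w)} =
    ⋃ j, ⋃ _ : j < J, {w | Ex (2 * j) (X w) (A w)} := by ext; simp
  exact this ▸ MeasurableSet.iUnion fun j => MeasurableSet.iUnion fun _ => Ex_meas _ _ _ hX hA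

lemma exp_le_one' (y : ℝ) (hy : y ∈ Icc (0 : ℝ) 1) : 0 ≤ 1 - Real.exp (-y) := by
  have : Real.exp (-y) ≤ 1 := Real.exp_le_one_iff.2 (by linarith [hy.1])
  linarith

lemma P_EA (t : ℝ) (ht : t ∈ Icc (0 : ℝ) 1) :
    Measure.infinitePi (fun _ : ℤ => lam) (EA t) = ENNReal.ofReal (Real.exp (-t) - 1 + t) := by
  have hm : MeasurableSet {p : ℝ × (ℕ → ℝ) | p.1 < t ∧ ¬ ∃ j, Ex (2 * j) p.1 p.2} :=
    (measurableSet_lt measurable_fst measurable_const).inter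
      (inf_meas (fun p : ℝ × (ℕ → ℝ) => p.1) (fun p => p.2) measurable_fst measurable_snd).compl
  have : Measure.infinitePi (fun _ : ℤ => lam) (EA t) =
      (lam.prod Q) {p | p.1 < t ∧ ¬ ∃ j, Ex (2 * j) p.1 p.2} := by
    rw [← sg_prod (-1 : ℤ) (fun n : ℕ => -1 - 1 - n) (fun a b h => by simpa using h)
      (fun n => by omega), Measure.map_apply (by fun_prop) hm]
    rfl
  rw [this, Measure.prod_apply hm, lint_aux (fun y => Real.exp (-y) + y)
    (fun y => 1 - Real.exp (-y)) _ (by fun_prop) t ht exp_le_one']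
  · simp; ring_nf
  · intro y hy
    split_ifs with h
    · have h1 : Prod.mk y ⁻¹' {p : ℝ × (ℕ → ℝ) | p.1 < t ∧ ¬ ∃ j, Ex (2 * j) p.1 p.2} =
        {a | ∃ j, Ex (2 * j) y a}ᶜ := by ext; simp [h]
      rw [h1, prob_compl_eq_one_sub (inf_meas (fun _ => y) (fun a => a) measurable_const measurable_id), Q_inf y hy,
        ENNReal.ofReal_sub _ (Real.exp_pos _).le, ENNReal.ofReal_one]
    · simp [h]
  · intro y
    have := ((hasDerivAt_neg y).exp).add (hasDerivAt_id y)
    convert! this using 1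
    ring

lemma P_EB (t : ℝ) (ht : t ∈ Icc (0 : ℝ) 1) :
    Measure.infinitePi (fun _ : ℤ => lam) {T | t < T 0} = ENNReal.ofReal (1 - t) := by
  have h := Q_Ex 0 t ht
  have e : ({T : ℤ → ℝ | t < T 0}) = (fun T (i : ℕ) => T (i : ℤ)) ⁻¹' {a | Ex 0 t a} := rfl
  rw [e, ← Measure.map_apply (by fun_prop) (Ex_meas 0 (fun _ => t) (fun a => a) measurable_const measurable_id),
    sg_map (fun i : ℕ => (i : ℤ)) Nat.cast_injective, h]
  simp [ee]

lemma F_deriv (J : ℕ) (y : ℝ) : HasDerivAt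
    (fun y : ℝ => Real.exp (-y) * ∑ i ∈ Finset.range J, y ^ (2 * i + 1) / (2 * i + 1).factorial)
    ((∑ i ∈ Finset.range (2 * J), (-y) ^ i / i.factorial) * Real.exp (-y)) y := by
  have h1 : HasDerivAt
    (fun y : ℝ => ∑ i ∈ Finset.range J, y ^ (2 * i + 1) / (2 * i + 1).factorial)
    (∑ i ∈ Finset.range J, y ^ (2 * i) / (2 * i).factorial) y :=
    HasDerivAt.fun_sum fun i _ => pow_deriv (2 * i) y
  have := ((hasDerivAt_neg y).exp).mul h1
  convert! this using 1
  rw [← ee_sum]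
  simp only [ee, Finset.sum_sub_distrib]
  ring

lemma P_EC (t : ℝ) (ht : t ∈ Icc (0 : ℝ) 1) (s : ℤ) (J : ℕ) :
    Measure.infinitePi (fun _ : ℤ => lam) (EC t s J) = ENNReal.ofReal
      (Real.exp (-t) * ∑ i ∈ Finset.range J, t ^ (2 * i + 1) / (2 * i + 1).factorial) := by
  have hm : MeasurableSet {p : ℝ × (ℕ → ℝ) × (ℕ → ℝ) | p.1 < t ∧
      (∃ j < J, Ex (2 * j) p.1 p.2.1) ∧ ∃ j, Ex (2 * j) p.1 p.2.2} :=
    (measurableSet_lt measurable_fst measurable_const).inter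
      ((fin_meas J (fun p : ℝ × (ℕ → ℝ) × (ℕ → ℝ) => p.1) (fun p => p.2.1) (by fun_prop)
        (by fun_prop)).inter (inf_meas (fun p : ℝ × (ℕ → ℝ) × (ℕ → ℝ) => p.1) (fun p => p.2.2)
        (by fun_prop) (by fun_prop)))
  have : Measure.infinitePi (fun _ : ℤ => lam) (EC t s J) =
      (lam.prod (Q.prod Q)) {p : ℝ × (ℕ → ℝ) × (ℕ → ℝ) | p.1 < t ∧
      (∃ j < J, Ex (2 * j) p.1 p.2.1) ∧ ∃ j, Ex (2 * j) p.1 p.2.2} := by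
    rw [← sg_prod3 s (fun n : ℕ => s - 1 - n) (fun n : ℕ => s + 1 + n)
      (fun a b h => by simpa using h) (fun a b h => by simpa using h)
      (fun n => by omega) (fun n => by omega) (fun n m => by omega),
      Measure.map_apply (by fun_prop) hm]
    rfl
  have hnn : ∀ y ∈ Icc (0 : ℝ) 1, 0 ≤ ∑ i ∈ Finset.range (2 * J), (-y) ^ i / i.factorial := by
    intro y hy
    rw [← ee_sum]
    exact Finset.sum_nonneg fun j _ => ee_nonneg _ y hy
  rw [this, Measure.prod_apply hm, lint_aux _ _ (F_deriv J) (by fun_prop) t ht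
    (fun y hy => mul_nonneg (hnn y hy) (Real.exp_pos _).le)]
  · simp
  · intro y hy
    split_ifs with h
    · have h1 : Prod.mk y ⁻¹' {p : ℝ × (ℕ → ℝ) × (ℕ → ℝ) | p.1 < t ∧
          (∃ j < J, Ex (2 * j) p.1 p.2.1) ∧ ∃ j, Ex (2 * j) p.1 p.2.2} =
        {a | ∃ j < J, Ex (2 * j) y a} ×ˢ {a | ∃ j, Ex (2 * j) y a} := by ext; simp [h]
      rw [h1, Measure.prod_prod, Q_inf y hy, Q_fin J y hy, ENNReal.ofReal_mul (hnn y hy)]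
    · simp [h]

theorem gamma_three (P : Measure (ℤ → ℝ)) (hP : IsUniformProduct P)
    (t : ℝ) (ht : t ∈ Icc (0 : ℝ) 1) (s : ℕ) (hs : 2 ≤ s) (hse : Even s) :
    (P (D t s ∩ M3 t)).toReal =
      (1 - t) * (Real.exp (-t) - 1 + t) * Real.exp (-t) *
        ∑ i ∈ Finset.range (s / 2), t ^ (2 * i + 1) / (Nat.factorial (2 * i + 1)) := by
  obtain ⟨J, rfl⟩ := even_iff_two_dvd.1 hse
  have hJ : 1 ≤ J := by omega
  rw [P_eq P hP, event_eq t J hJ, Nat.mul_div_cancel_left J (by norm_num : 0 < 2)]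
  have hB : MeasurableSet[sg {(0 : ℤ)}] {T : ℤ → ℝ | t < T 0} :=
    measurableSet_lt measurable_const (sg_eval rfl)
  have mono : ∀ {S S' : Set ℤ}, S ⊆ S' → sg S ≤ sg S' := fun h => biSup_mono h
  have hC := EC_meas t J hJ
  have i1 := (Indep_iff _ _ _).1 (sg_indep (S := {(0 : ℤ)}) (S' := Ioi 0) (by simp)) _ _ hB hC
  have i2 := (Indep_iff _ _ _).1 (sg_indep (S := Iio (0 : ℤ)) (S' := Ici 0)
    (Set.disjoint_left.2 fun x h h' => by simp only [mem_Iio, mem_Ici] at h h'; omega)) _ _ (EA_meas t)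
    (MeasurableSet.inter (mono (by simp) _ hB) (mono Ioi_subset_Ici_self _ hC))
  rw [i2, i1, P_EA t ht, P_EB t ht, P_EC t ht]
  have e1 : 0 ≤ Real.exp (-t) - 1 + t := by linarith [Real.add_one_le_exp (-t)]
  have e2 : 0 ≤ 1 - t := by linarith [ht.2]
  have e3 : 0 ≤ Real.exp (-t) * ∑ i ∈ Finset.range J, t ^ (2 * i + 1) / (2 * i + 1).factorial :=
    mul_nonneg (Real.exp_pos _).le (Finset.sum_nonneg fun i _ =>
      div_nonneg (pow_nonneg ht.1 _) (by positivity))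
  rw [ENNReal.toReal_mul, ENNReal.toReal_mul, ENNReal.toReal_ofReal e1, ENNReal.toReal_ofReal e2,
    ENNReal.toReal_ofReal e3]
  ring
end
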